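/- Let H be a division ring of finite dimension over its center k, with k of characteristic zero, and let F be a division ring that is a classical right quotient ring of the ring H[X] of polynomial functions on H (via an injective ring homomorphism). Then for every m ≥ 4 the alternating group A_m occurs as the Galois group of a Galois extension of F: there exist a division ring M and an injective ring homomorphism ι : F → M such that M/F is Galois with Galois group isomorphic to A_m. -/

import Mathlib

universe u v w x

/-- The subgroup of ring automorphisms of `M` fixing the image of `ι` pointwise
(the Galois group of the extension `M/F` given by `ι`). -/
def fixingAut {F M : Type*} [DivisionRing F] [DivisionRing M] (ι : F →+* M) :
    Subgroup (RingAut M) where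
  carrier := {σ | ∀ x : F, σ (ι x) = ι x}
  one_mem' := fun _ => rfl
  mul_mem' := by
    intro a b ha hb x
    show a (b (ι x)) = ι x
    rw [hb x, ha x]
  inv_mem' := by
    intro a ha x
    show a.symm (ι x) = ι x
    conv_lhs => rw [← ha x]
    exact a.symm_apply_apply _

/-- The extension `M/F` given by `ι : F →+* M` is Galois: every element of `M` fixed by all
ring automorphisms of `M` fixing `ι(F)` pointwise lies in `ι(F)`. -/
def IsGaloisExt {F M : Type*} [DivisionRing F] [DivisionRing M] (ι : F →+* M) : Prop :=
  ∀ m : M, (∀ σ ∈ fixingAut ι, σ m = m) → m ∈ Set.range ι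

/-- The ring `H[X]` of polynomial functions on a division ring `H`: the subring of `H → H`
(with pointwise operations) generated by the constant functions and the identity function. -/
def polyFunRing (H : Type*) [DivisionRing H] : Subring (H → H) :=
  Subring.closure ({f | ∃ c : H, f = Function.const H c} ∪ {id})

/-- `F` is a classical right quotient ring of `R` via the injective ring homomorphism `φ`:
every element of `F` is of the form `φ a * (φ b)⁻¹` with `b ≠ 0`. -/
def IsClassicalRightQuotient {R F : Type*} [Ring R] [DivisionRing F] (φ : R →+* F) : Prop :=
  Function.Injective φ ∧ ∀ x : F, ∃ a b : R, b ≠ 0 ∧ x = φ a * (φ b)⁻¹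

/-- Auxiliary construction for the iterated polynomial ring. -/
noncomputable def IterPolyAux (H : Type u) [Ring H] : ℕ → ((T : Type u) × Ring T)
  | 0 => ⟨H, inferInstance⟩
  | n + 1 =>
    letI := (IterPolyAux H n).2
    ⟨Polynomial (IterPolyAux H n).1, inferInstance⟩

/-- The iterated polynomial ring `H_c[t₁, …, t_n]` in `n` central variables over `H`:
`IterPoly H 0 = H` and `IterPoly H (n + 1) = Polynomial (IterPoly H n)`. -/
def IterPoly (H : Type u) [Ring H] (n : ℕ) : Type u := (IterPolyAux H n).1

noncomputable instance (H : Type u) [Ring H] (n : ℕ) : Ring (IterPoly H n) :=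
  (IterPolyAux H n).2

open Polynomial Finset
open scoped TensorProduct

section CauchyKernel

variable {ι K : Type*} [DecidableEq ι] [Field K]

/-- `v` is in the kernel of the skew-symmetric matrix `1 / (a i - a j)` indexed by `s`. -/
def IsCauchyKernel (a v : ι → K) (s : Finset ι) : Prop :=
  ∀ i ∈ s, ∑ j ∈ s.erase i, v j / (a i - a j) = 0

theorem Finset.sum_sum_erase_comm (s : Finset ι) (F : ι → ι → K) :
    ∑ i ∈ s, ∑ j ∈ s.erase i, F i j = ∑ i ∈ s, ∑ j ∈ s.erase i, F j i := by
  refine Finset.sum_comm' fun x y => ?_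
  simp only [mem_erase]
  tauto

theorem Finset.sq_sum_eq_sum_sq_add (s : Finset ι) (u : ι → K) :
    (∑ i ∈ s, u i) ^ 2 = ∑ i ∈ s, u i ^ 2 + ∑ i ∈ s, ∑ j ∈ s.erase i, u i * u j := by
  rw [sq, Finset.sum_mul_sum, ← Finset.sum_add_distrib]
  refine Finset.sum_congr rfl fun i hi => ?_
  rw [← Finset.add_sum_erase s _ hi, sq]

theorem IsCauchyKernel.sq_sum_div {a v : ι → K} {s : Finset ι} (h : IsCauchyKernel a v s)
    (ha : Set.InjOn a s) {x : K} (hx : ∀ i ∈ s, x - a i ≠ 0) :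
    (∑ i ∈ s, v i / (x - a i)) ^ 2 = ∑ i ∈ s, v i ^ 2 / (x - a i) ^ 2 := by
  have key : ∑ i ∈ s, ∑ j ∈ s.erase i, v i / (x - a i) * (v j / (a i - a j)) = 0 := by
    refine Finset.sum_eq_zero fun i hi => ?_
    rw [← Finset.mul_sum, h i hi, mul_zero]
  have : ∑ i ∈ s, ∑ j ∈ s.erase i, v i / (x - a i) * (v j / (x - a j)) =
      ∑ i ∈ s, ∑ j ∈ s.erase i, v i / (x - a i) * (v j / (a i - a j)) +
      ∑ i ∈ s, ∑ j ∈ s.erase i, v j / (x - a j) * (v i / (a j - a i)) := by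
    rw [← Finset.sum_add_distrib]
    refine Finset.sum_congr rfl fun i hi => ?_
    rw [← Finset.sum_add_distrib]
    refine Finset.sum_congr rfl fun j hj => ?_
    have hj' := Finset.mem_of_mem_erase hj
    have h1 : a i - a j ≠ 0 := fun h0 =>
      Finset.ne_of_mem_erase hj (ha hj' hi (sub_eq_zero.1 h0).symm)
    have h2 : a j - a i ≠ 0 := by rwa [← neg_sub, neg_ne_zero]
    have := hx i hi
    have := hx j hj'
    rw [← neg_sub (a i) (a j)]
    field_simp
    ring
  rw [Finset.sq_sum_eq_sum_sq_add, this, ← Finset.sum_sum_erase_comm s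
    (fun i j => v i / (x - a i) * (v j / (a i - a j))), key]
  simp [div_pow]

theorem IsCauchyKernel.sq_sum {a v : ι → K} {s : Finset ι} (h : IsCauchyKernel a v s)
    (ha : Set.InjOn a s) : (∑ i ∈ s, v i) ^ 2 = ∑ i ∈ s, v i ^ 2 := by
  have key : ∑ i ∈ s, ∑ j ∈ s.erase i, a i * v i * (v j / (a i - a j)) = 0 := by
    refine Finset.sum_eq_zero fun i hi => ?_
    rw [← Finset.mul_sum, h i hi, mul_zero]
  have : ∑ i ∈ s, ∑ j ∈ s.erase i, v i * v j =
      ∑ i ∈ s, ∑ j ∈ s.erase i, a i * v i * (v j / (a i - a j)) +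
      ∑ i ∈ s, ∑ j ∈ s.erase i, a j * v j * (v i / (a j - a i)) := by
    rw [← Finset.sum_add_distrib]
    refine Finset.sum_congr rfl fun i hi => ?_
    rw [← Finset.sum_add_distrib]
    refine Finset.sum_congr rfl fun j hj => ?_
    have h1 : a i - a j ≠ 0 := fun h0 =>
      Finset.ne_of_mem_erase hj (ha (Finset.mem_of_mem_erase hj) hi (sub_eq_zero.1 h0).symm)
    have h2 : a j - a i ≠ 0 := by rwa [← neg_sub, neg_ne_zero]
    rw [← neg_sub (a i) (a j)]
    field_simp
    ring
  rw [Finset.sq_sum_eq_sum_sq_add, this, ← Finset.sum_sum_erase_comm s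
    (fun i j => a i * v i * (v j / (a i - a j))), key]
  simp

theorem Polynomial.exists_isRoot_of_odd_natDegree_real {P : ℝ[X]} (hP : Odd P.natDegree) :
    ∃ x, P.IsRoot x := by
  by_contra! hroot
  wlog hlc : 0 ≤ P.leadingCoeff generalizing P
  · refine this (P := -P) (by simpa using hP) (fun x hx => hroot x ?_) ?_
    · simpa [IsRoot.def] using hx
    · rw [leadingCoeff_neg]
      linarith
  have h1 := zero_lt_eval_of_roots_lt_of_leadingCoeff_nonneg (P := P) (x := 0)
    (fun y hy => absurd hy (hroot y)) hlc
  have h2 := zero_lt_negOnePow_mul_eval_of_lt_roots_of_leadingCoeff_nonneg (P := P) (x := 0)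
    (fun y hy => absurd hy (hroot y)) hlc
  rw [Int.negOnePow_odd _ (by exact_mod_cast hP)] at h2
  push_cast at h2
  linarith

theorem IsCauchyKernel.eq_zero_of_even_card {a v : ι → ℝ} {s : Finset ι}
    (h : IsCauchyKernel a v s) (ha : Set.InjOn a s) (hs : Even s.card) : ∀ i ∈ s, v i = 0 := by
  by_contra! hv
  obtain ⟨i₀, hi₀, hvi₀⟩ := hv
  have hsum : ∑ i ∈ s, v i ≠ 0 := by
    intro h0
    have h1 := h.sq_sum ha
    rw [h0] at h1
    have := (Finset.sum_eq_zero_iff_of_nonneg fun i _ => sq_nonneg (v i)).1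
      (h1.symm.trans (by norm_num)) i₀ hi₀
    exact hvi₀ (by simpa using this)
  have hpos : 0 < s.card := Finset.card_pos.2 ⟨i₀, hi₀⟩
  set P : ℝ[X] := ∑ i ∈ s, C (v i) * ∏ j ∈ s.erase i, (X - C (a j)) with hP
  have hdegle : P.natDegree ≤ s.card - 1 := by
    refine natDegree_sum_le_of_forall_le _ _ fun i hi => ?_
    refine (natDegree_C_mul_le _ _).trans ?_
    rw [natDegree_finsetProd_X_sub_C_eq_card, Finset.card_erase_of_mem hi]
  have hcoeff : P.coeff (s.card - 1) = ∑ i ∈ s, v i := by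
    rw [hP, finsetSum_coeff]
    refine Finset.sum_congr rfl fun i hi => ?_
    rw [coeff_C_mul]
    have hm : (∏ j ∈ s.erase i, (X - C (a j))).Monic := monic_prod_of_monic _ _ fun j _ =>
      monic_X_sub_C _
    have hd : (∏ j ∈ s.erase i, (X - C (a j))).natDegree = s.card - 1 := by
      rw [natDegree_finsetProd_X_sub_C_eq_card, Finset.card_erase_of_mem hi]
    rw [← hd, hm.coeff_natDegree, mul_one]
  have hdeg : P.natDegree = s.card - 1 :=
    le_antisymm hdegle (le_natDegree_of_ne_zero (by rwa [hcoeff]))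
  obtain ⟨x, hx⟩ := exists_isRoot_of_odd_natDegree_real (P := P)
    (by rw [hdeg]; exact Nat.Even.sub_odd hpos hs odd_one)
  have heval : ∑ i ∈ s, v i * ∏ j ∈ s.erase i, (x - a j) = 0 := by
    have := hx
    rw [IsRoot.def, hP, eval_finsetSum] at this
    simpa [eval_prod] using this
  by_cases hxa : ∃ i ∈ s, x = a i
  · obtain ⟨i, hi, rfl⟩ := hxa
    have hvi : v i = 0 := by
      rw [Finset.sum_eq_single_of_mem i hi] at heval
      · refine (mul_eq_zero.1 heval).resolve_right (Finset.prod_ne_zero_iff.2 fun j hj h0 => ?_)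
        exact Finset.ne_of_mem_erase hj
          (ha (Finset.mem_of_mem_erase hj) hi (sub_eq_zero.1 h0).symm)
      · intro j _ hji
        rw [Finset.prod_eq_zero (Finset.mem_erase.2 ⟨hji.symm, hi⟩) (sub_self _), mul_zero]
    have hk : IsCauchyKernel a v (s.erase i) := by
      intro l hl
      have hls := Finset.mem_of_mem_erase hl
      have := h l hls
      rwa [← Finset.add_sum_erase _ _ (Finset.mem_erase.2 ⟨(Finset.ne_of_mem_erase hl).symm, hi⟩),
        hvi, zero_div, zero_add, Finset.erase_right_comm] at this
    have hsq := hk.sq_sum_div (x := a i) (ha.mono (by simp)) fun j hj h0 =>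
      Finset.ne_of_mem_erase hj (ha (Finset.mem_of_mem_erase hj) hi (sub_eq_zero.1 h0).symm)
    rw [h i hi, zero_pow two_ne_zero] at hsq
    have hne : i₀ ≠ i := by rintro rfl; exact hvi₀ hvi
    have h0 := (Finset.sum_eq_zero_iff_of_nonneg fun j _ => by positivity).1 hsq.symm i₀
      (Finset.mem_erase.2 ⟨hne, hi₀⟩)
    rcases div_eq_zero_iff.1 h0 with h0 | h0
    · exact hvi₀ (by simpa using h0)
    · exact hne (ha hi₀ hi (sub_eq_zero.1 (by simpa using h0)).symm)
  · push Not at hxa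
    have hxa' : ∀ i ∈ s, x - a i ≠ 0 := fun i hi => sub_ne_zero.2 (hxa i hi)
    have hsq := h.sq_sum_div ha hxa'
    have h1 : ∑ i ∈ s, v i / (x - a i) = 0 := by
      have hprod : ∏ j ∈ s, (x - a j) ≠ 0 := Finset.prod_ne_zero_iff.2 hxa'
      refine (mul_eq_zero.1 (?_ : (∏ j ∈ s, (x - a j)) * _ = 0)).resolve_left hprod
      rw [Finset.mul_sum, ← heval]
      refine Finset.sum_congr rfl fun i hi => ?_
      rw [← Finset.mul_prod_erase s _ hi]
      have := hxa' i hi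
      field_simp
    rw [h1, zero_pow two_ne_zero] at hsq
    have h0 := (Finset.sum_eq_zero_iff_of_nonneg fun j _ => by positivity).1 hsq.symm i₀ hi₀
    rcases div_eq_zero_iff.1 h0 with h0 | h0
    · exact hvi₀ (by simpa using h0)
    · exact hxa' i₀ hi₀ (by simpa using h0)

end CauchyKernel

section ModP

variable {ι : Type*} [DecidableEq ι]

/-- The product of all differences of the integers `n i`, `i ∈ s`. -/
def cauchyDenominator (n : ι → ℤ) (s : Finset ι) : ℤ :=
  ∏ i ∈ s, ∏ j ∈ s.erase i, (n i - n j)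

/-- The matrix `1 / (n i - n j)` with denominators cleared. -/
def cauchyIntMatrix (n : ι → ℤ) (s : Finset ι) : Matrix s s ℤ :=
  fun i j => if i = j then 0 else cauchyDenominator n s / (n i - n j)

theorem sub_dvd_cauchyDenominator (n : ι → ℤ) {s : Finset ι} {i j : ι} (hi : i ∈ s)
    (hj : j ∈ s.erase i) : n i - n j ∣ cauchyDenominator n s :=
  (Finset.dvd_prod_of_mem _ hj).trans
    (Finset.dvd_prod_of_mem (fun i => ∏ j ∈ s.erase i, (n i - n j)) hi)

theorem cauchyIntMatrix_mulVec {K : Type*} [Field K] (n : ι → ℤ) (s : Finset ι)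
    (hD : (cauchyDenominator n s : K) ≠ 0) (v : ι → K) (i : s) :
    ((cauchyIntMatrix n s).map (Int.cast : ℤ → K)).mulVec (fun j => v j) i =
      cauchyDenominator n s * ∑ j ∈ s.erase i, v j / ((n i : K) - n j) := by
  have hterm : ∀ j : s, (cauchyIntMatrix n s i j : K) * v j =
      if (j : ι) ∈ s.erase i then (cauchyDenominator n s : K) * (v j / ((n i : K) - n j))
      else 0 := by
    intro j
    by_cases hij : i = j
    · simp [cauchyIntMatrix, hij]
    · have hj : (j : ι) ∈ s.erase i := by
        refine Finset.mem_erase.2 ⟨fun h => hij (Subtype.ext h.symm), j.2⟩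
      obtain ⟨q, hq⟩ := sub_dvd_cauchyDenominator n i.2 hj
      have hne : ((n i : K) - n j) ≠ 0 := by
        intro h0
        apply hD
        rw [hq]
        push_cast
        rw [h0, zero_mul]
      have hne' : n i - n j ≠ 0 := by
        intro h0
        apply hne
        exact_mod_cast congrArg (Int.cast : ℤ → K) h0
      rw [if_pos hj, cauchyIntMatrix, if_neg hij, hq, Int.mul_ediv_cancel_left _ hne']
      push_cast
      field_simp
  simp only [Matrix.mulVec, dotProduct, Matrix.map_apply]
  rw [Finset.sum_congr rfl fun j _ => hterm j, Finset.mul_sum,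
    Finset.sum_coe_sort s (fun j => if j ∈ s.erase (i : ι) then
      (cauchyDenominator n s : K) * (v j / ((n i : K) - n j)) else 0), ← Finset.sum_filter]
  refine Finset.sum_congr ?_ fun _ _ => rfl
  ext j
  simp

theorem det_cauchyIntMatrix_ne_zero {n : ι → ℤ} {s : Finset ι} (hn : Set.InjOn n s)
    (hs : Even s.card) : (cauchyIntMatrix n s).det ≠ 0 := by
  intro hdet
  obtain ⟨v, hv, hMv⟩ := Matrix.exists_mulVec_eq_zero_iff.2 hdet
  have hD : (cauchyDenominator n s : ℝ) ≠ 0 := by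
    rw [Int.cast_ne_zero, cauchyDenominator]
    refine Finset.prod_ne_zero_iff.2 fun i hi => Finset.prod_ne_zero_iff.2 fun j hj h0 => ?_
    exact Finset.ne_of_mem_erase hj (hn (Finset.mem_of_mem_erase hj) hi (sub_eq_zero.1 h0).symm)
  set w : ι → ℝ := fun i => if h : i ∈ s then (v ⟨i, h⟩ : ℝ) else 0 with hw
  have hwv : (fun j : s => w j) = fun j => (v j : ℝ) := by
    funext j
    simp [hw]
  have hker : IsCauchyKernel (fun i => (n i : ℝ)) w s := by
    intro i hi
    have h1 := cauchyIntMatrix_mulVec n s hD w ⟨i, hi⟩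
    have h2 : ((cauchyIntMatrix n s).map (Int.cast : ℤ → ℝ)).mulVec (fun j => w j) = 0 := by
      rw [hwv]
      have := congrArg (fun u : s → ℤ => fun j => (u j : ℝ)) hMv
      funext j
      have := congrFun this j
      simpa [Matrix.mulVec, dotProduct] using this
    rw [h2] at h1
    exact (mul_eq_zero.1 h1.symm).resolve_left hD
  have h0 := hker.eq_zero_of_even_card (fun i hi j hj h => hn hi hj (Int.cast_injective h)) hs
  apply hv
  funext j
  have := congrFun hwv j
  simp only [h0 j j.2] at this
  exact_mod_cast this.symm

theorem exists_forall_prime_cauchyKernel_eq_zero {n : ι → ℤ} {s : Finset ι}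
    (hn : Set.InjOn n s) (hs : Even s.card) :
    ∃ B : ℕ, ∀ p : ℕ, (hp : p.Prime) → B < p → haveI := Fact.mk hp
      ∀ v : ι → ZMod p, IsCauchyKernel (fun i => (n i : ZMod p)) v s → ∀ i ∈ s, v i = 0 := by
  have hD : cauchyDenominator n s ≠ 0 := by
    refine Finset.prod_ne_zero_iff.2 fun i hi => Finset.prod_ne_zero_iff.2 fun j hj h0 => ?_
    exact Finset.ne_of_mem_erase hj (hn (Finset.mem_of_mem_erase hj) hi (sub_eq_zero.1 h0).symm)
  have hdet := det_cauchyIntMatrix_ne_zero hn hs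
  have hlarge : ∀ (z : ℤ) (p : ℕ), z ≠ 0 → z.natAbs < p → (z : ZMod p) ≠ 0 := by
    intro z p hz hzp h0
    rw [ZMod.intCast_zmod_eq_zero_iff_dvd] at h0
    have := Int.natAbs_dvd_natAbs.2 h0
    exact absurd (Nat.le_of_dvd (Int.natAbs_pos.2 hz) this) (by simpa using hzp)
  refine ⟨max (cauchyDenominator n s).natAbs (cauchyIntMatrix n s).det.natAbs, ?_⟩
  intro p hp hBp v hv i hi
  have := Fact.mk hp
  have hDp := hlarge _ p hD ((le_max_left _ _).trans_lt hBp)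
  have hdp := hlarge _ p hdet ((le_max_right _ _).trans_lt hBp)
  have h1 : ((cauchyIntMatrix n s).map (Int.cast : ℤ → ZMod p)).mulVec (fun j => v j) = 0 := by
    funext j
    rw [cauchyIntMatrix_mulVec n s hDp v j, hv j j.2, mul_zero, Pi.zero_apply]
  have h2 : ((cauchyIntMatrix n s).map (Int.cast : ℤ → ZMod p)).det ≠ 0 := by
    have := Int.cast_det (R := ZMod p) (cauchyIntMatrix n s)
    rwa [← this]
  exact congrFun (Matrix.eq_zero_of_mulVec_eq_zero h2 h1) ⟨i, hi⟩

theorem sum_div_zmod_eq_zero (p : ℕ) [Fact p.Prime] (s : Finset ι) (num u : ι → ℤ)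
    (hu : ∀ i ∈ s, ¬ (p : ℤ) ∣ u i) (h : ∑ i ∈ s, (num i : ℚ) / u i = 0) :
    ∑ i ∈ s, (num i : ZMod p) / u i = 0 := by
  have hclear : ∀ (K : Type) [Field K], (∀ i ∈ s, (u i : K) ≠ 0) →
      ((∑ i ∈ s, num i * ∏ j ∈ s.erase i, u j : ℤ) : K) =
        (∏ j ∈ s, (u j : K)) * ∑ i ∈ s, (num i : K) / u i := by
    intro K _ hK
    push_cast
    rw [Finset.mul_sum]
    refine Finset.sum_congr rfl fun i hi => ?_
    rw [← Finset.mul_prod_erase s _ hi]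
    have := hK i hi
    field_simp
  have hp : ∀ i ∈ s, (u i : ZMod p) ≠ 0 := fun i hi h0 =>
    hu i hi ((ZMod.intCast_zmod_eq_zero_iff_dvd _ _).1 h0)
  have h1 := hclear ℚ fun i hi h0 => hu i hi (by
    rw [Int.cast_eq_zero] at h0
    simp [h0])
  rw [h, mul_zero, Int.cast_eq_zero] at h1
  have h2 := hclear (ZMod p) hp
  rw [h1, Int.cast_zero] at h2
  exact (mul_eq_zero.1 h2.symm).resolve_left (Finset.prod_ne_zero_iff.2 hp)

end ModP

/-- Modulo the prime `p`, the nodes `a i`, `i ∈ τ`, collapse to `0` as `a i = p * b i` with distinct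
`b i`, the other nodes stay distinct and nonzero, and the weights `c i`, `i ∈ τ`, are units. -/
structure IsCluster {ι : Type*} (a c : ι → ℤ) (τ : Finset ι) (p : ℕ) (b : ι → ℤ) : Prop where
  eq_mul : ∀ i ∈ τ, a i = p * b i
  not_dvd_sub : ∀ i ∈ τ, ∀ j ∈ τ, i ≠ j → ¬ (p : ℤ) ∣ b i - b j
  not_dvd_weight : ∀ i ∈ τ, ¬ (p : ℤ) ∣ c i
  not_dvd_node : ∀ q ∉ τ, ¬ (p : ℤ) ∣ a q
  not_dvd_node_sub : ∀ q ∉ τ, ∀ r ∉ τ, q ≠ r → ¬ (p : ℤ) ∣ a q - a r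

theorem exists_primitive_cauchyKernel {ι : Type*} [Fintype ι] [DecidableEq ι]
    (hι : Odd (Fintype.card ι)) (a : ι → ℤ) :
    ∃ c : ι → ℤ, univ.gcd c = 1 ∧
      IsCauchyKernel (fun i => (a i : ℚ)) (fun i => (c i : ℚ)) univ := by
  set M : Matrix ι ι ℚ := fun i j => 1 / ((a i : ℚ) - a j) with hM
  have hdet : M.det = 0 := by
    have hT : M.transpose = -M := by
      ext i j
      change 1 / ((a j : ℚ) - a i) = -(1 / ((a i : ℚ) - a j))
      rw [← neg_sub (a i : ℚ) (a j : ℚ), div_neg]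
    have h1 : M.det = -M.det := by
      conv_lhs => rw [← Matrix.det_transpose, hT, Matrix.det_neg, hι.neg_one_pow]
      ring
    linarith
  obtain ⟨v, hv, hMv⟩ := Matrix.exists_mulVec_eq_zero_iff.2 hdet
  have hrow : ∀ i, ∑ j ∈ univ.erase i, v j / ((a i : ℚ) - a j) = 0 := by
    intro i
    have := congrFun hMv i
    simp only [Matrix.mulVec, dotProduct, hM, Pi.zero_apply] at this
    rw [← Finset.add_sum_erase _ _ (mem_univ i), sub_self, div_zero, zero_mul, zero_add] at this
    rw [← this]
    exact Finset.sum_congr rfl fun j _ => by ring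
  obtain ⟨d, hd⟩ := IsLocalization.exist_integer_multiples_of_finset (nonZeroDivisors ℤ)
    (univ.image v)
  have hd' : ∀ i, ∃ z : ℤ, (z : ℚ) = (d : ℤ) * v i := by
    intro i
    obtain ⟨z, hz⟩ := hd (v i) (mem_image_of_mem _ (mem_univ i))
    exact ⟨z, by simpa using hz⟩
  choose z hz using hd'
  have hd0 : ((d : ℤ) : ℚ) ≠ 0 := by exact_mod_cast nonZeroDivisors.ne_zero d.2
  obtain ⟨i₀, hi₀⟩ := Function.ne_iff.1 hv
  obtain ⟨c, hc, hgcd⟩ := Finset.extract_gcd (s := univ) z ⟨i₀, mem_univ _⟩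
  refine ⟨c, hgcd, fun i _ => ?_⟩
  have hg0 : ((univ.gcd z : ℤ) : ℚ) ≠ 0 := by
    intro h0
    have h1 : (z i₀ : ℚ) = 0 := by
      rw [hc i₀ (mem_univ _)]
      push_cast
      rw [h0, zero_mul]
    rw [hz] at h1
    exact (mul_ne_zero hd0 hi₀) h1
  refine (mul_eq_zero.1 (?_ : ((univ.gcd z : ℤ) : ℚ) * _ = 0)).resolve_left hg0
  rw [Finset.mul_sum]
  have : ∀ j, ((univ.gcd z : ℤ) : ℚ) * ((c j : ℚ) / ((a i : ℚ) - a j)) =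
      (d : ℤ) * (v j / ((a i : ℚ) - a j)) := by
    intro j
    rw [← mul_div_assoc, ← mul_div_assoc, ← hz, hc j (mem_univ _)]
    push_cast
    rfl
  rw [Finset.sum_congr rfl fun j _ => this j, ← Finset.mul_sum, hrow, mul_zero]

theorem exists_injective_primes (α : Type*) [Fintype α] (B : ℕ) :
    ∃ p : α → ℕ, Function.Injective p ∧ ∀ i, (p i).Prime ∧ B < p i := by
  classical
  have hinf : {q : ℕ | q.Prime ∧ B < q}.Infinite := by
    refine Set.infinite_of_not_bddAbove fun ⟨M, hM⟩ => ?_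
    obtain ⟨q, hq, hqp⟩ := Nat.exists_infinite_primes (max M B + 1)
    have := hM (show q ∈ {q : ℕ | q.Prime ∧ B < q} from ⟨hqp, by omega⟩)
    omega
  refine ⟨fun i => (hinf.natEmbedding _ (Fintype.equivFin α i) : ℕ), fun i j hij => ?_, fun i =>
    (hinf.natEmbedding _ (Fintype.equivFin α i)).2⟩
  exact (Fintype.equivFin α).injective (Fin.ext ((hinf.natEmbedding _).injective (Subtype.ext hij)))

theorem exists_nodes {N : ℕ} (p : Finset (Fin N) → ℕ) (hpinj : Function.Injective p)
    (hp : ∀ τ, (p τ).Prime) :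
    ∃ a : Fin N → ℕ, ∀ τ i, a i ≡ (if i ∈ τ then p τ * i else i + 1) [MOD p τ ^ 2] := by
  have hco : ((univ : Finset (Finset (Fin N))) : Set (Finset (Fin N))).Pairwise
      (Function.onFun Nat.Coprime fun τ => p τ ^ 2) := by
    intro τ _ τ' _ hne
    exact Nat.Coprime.pow _ _ ((Nat.coprime_primes (hp τ) (hp τ')).2 (hpinj.ne hne))
  refine ⟨fun i => (Nat.chineseRemainderOfFinset (fun τ => if i ∈ τ then p τ * i else i + 1)
    (fun τ => p τ ^ 2) univ (fun τ _ => pow_ne_zero _ (hp τ).ne_zero) hco : ℕ), fun τ i => ?_⟩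
  exact (Nat.chineseRemainderOfFinset (fun τ => if i ∈ τ then p τ * i else i + 1)
    (fun τ => p τ ^ 2) univ (fun τ _ => pow_ne_zero _ (hp τ).ne_zero) hco).2 τ (mem_univ _)

theorem isCluster_of_modEq {N : ℕ} {a c : Fin N → ℤ} (hgcd : univ.gcd c = 1)
    (hker : IsCauchyKernel (fun i => (a i : ℚ)) (fun i => (c i : ℚ)) univ)
    {τ : Finset (Fin N)} (hτ : τ.card = 3) {p : ℕ} (hp : p.Prime) (hNp : N < p)
    (hC : haveI := Fact.mk hp; ∀ v : Fin N → ZMod p,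
      IsCauchyKernel (fun i : Fin N => (((i : ℕ) + 1 : ℤ) : ZMod p)) v τᶜ → ∀ i ∈ τᶜ, v i = 0)
    {b : Fin N → ℤ} (hab : ∀ i ∈ τ, a i = p * b i)
    (hb : ∀ i ∈ τ, (p : ℤ) ∣ b i - (i : ℕ)) (ha : ∀ i ∉ τ, (p : ℤ) ∣ a i - ((i : ℕ) + 1)) :
    IsCluster a c τ p b := by
  have := Fact.mk hp
  have hsmall : ∀ z : ℤ, (p : ℤ) ∣ z → |z| < p → z = 0 := fun z hz hlt =>
    Int.eq_zero_of_abs_lt_dvd hz hlt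
  have hbsub : ∀ i ∈ τ, ∀ j ∈ τ, i ≠ j → ¬ (p : ℤ) ∣ b i - b j := by
    intro i hi j hj hij hdvd
    have h1 : (p : ℤ) ∣ ((i : ℕ) : ℤ) - (j : ℕ) := by
      have := dvd_sub (dvd_add hdvd (hb j hj)) (hb i hi)
      ring_nf at this
      rwa [sub_eq_neg_add]
    have := hsmall _ h1 (by rw [abs_lt]; constructor <;> omega)
    exact hij (Fin.ext (by omega))
  have hnode : ∀ q ∉ τ, ¬ (p : ℤ) ∣ a q := by
    intro q hq hdvd
    have h1 := (dvd_sub hdvd (ha q hq))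
    ring_nf at h1
    have := hsmall _ h1 (by rw [abs_lt]; constructor <;> omega)
    omega
  have hnodesub : ∀ q ∉ τ, ∀ r ∉ τ, q ≠ r → ¬ (p : ℤ) ∣ a q - a r := by
    intro i hi j hj hij hdvd
    have h1 : (p : ℤ) ∣ ((i : ℕ) : ℤ) - (j : ℕ) := by
      have := dvd_sub hdvd (dvd_sub (ha i hi) (ha j hj))
      ring_nf at this
      exact this
    have := hsmall _ h1 (by rw [abs_lt]; constructor <;> omega)
    exact hij (Fin.ext (by omega))
  have hcross : ∀ i ∈ τ, ∀ q ∉ τ, ¬ (p : ℤ) ∣ a i - a q := by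
    intro i hi q hq hdvd
    refine hnode q hq ?_
    have : (p : ℤ) ∣ a i := ⟨b i, hab i hi⟩
    have h2 := dvd_sub this hdvd
    simpa using h2
  have hrowτ : IsCauchyKernel (fun i => (b i : ZMod p)) (fun i => (c i : ZMod p)) τ := by
    intro i hi
    have h1 := hker i (mem_univ i)
    have h2 := sum_div_zmod_eq_zero p (univ.erase i) (fun j => if j ∈ τ then c j else p * c j)
      (fun j => if j ∈ τ then b i - b j else a i - a j) (by
        intro j hj
        by_cases hjτ : j ∈ τ
        · simp only [hjτ, if_true]
          exact hbsub i hi j hjτ (Finset.ne_of_mem_erase hj).symm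
        · simp only [hjτ, if_false]
          exact hcross i hi j hjτ) (by
        rw [← mul_zero (p : ℚ), ← h1, Finset.mul_sum]
        refine Finset.sum_congr rfl fun j hj => ?_
        have hp0 : (p : ℚ) ≠ 0 := by exact_mod_cast hp.ne_zero
        by_cases hjτ : j ∈ τ
        · simp only [hjτ, if_true, hab i hi, hab j hjτ]
          push_cast
          rw [← mul_sub, ← mul_div_assoc, mul_div_mul_left _ _ hp0]
        · simp only [hjτ, if_false]
          push_cast
          ring)
    have h3 : ∑ j ∈ τ.erase i, (c j : ZMod p) / ((b i : ZMod p) - b j) =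
        ∑ j ∈ univ.erase i, ((if j ∈ τ then c j else p * c j : ℤ) : ZMod p) /
          ((if j ∈ τ then b i - b j else a i - a j : ℤ) : ZMod p) := by
      refine (Finset.sum_subset_zero_on_sdiff (Finset.erase_subset_erase _ (subset_univ _)) ?_ ?_)
      · intro j hj
        have hjτ : j ∉ τ := by
          simp only [mem_sdiff, mem_erase, mem_univ, and_true, not_and] at hj
          exact hj.2 hj.1
        simp [hjτ]
      · intro j hj
        simp [Finset.mem_of_mem_erase hj]
    exact h3.trans h2
  have hpair : ∀ i ∈ τ, (c i : ZMod p) = 0 → ∀ j ∈ τ, (c j : ZMod p) = 0 := by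
    intro i hi hci j hj
    by_cases hij : i = j
    · exact hij ▸ hci
    obtain ⟨l, hl⟩ : ∃ l, (τ.erase i).erase j = {l} := by
      rw [← Finset.card_eq_one, card_erase_of_mem (mem_erase.2 ⟨Ne.symm hij, hj⟩),
        card_erase_of_mem hi, hτ]
    have hlmem : l ∈ (τ.erase i).erase j := by simp [hl]
    simp only [mem_erase] at hlmem
    have hrow := hrowτ l hlmem.2.2
    have hset : τ.erase l = {i, j} := by
      have h3 : {i, j, l} = τ := Finset.eq_of_subset_of_card_le
        (by
          intro x hx
          simp only [mem_insert, mem_singleton] at hx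
          rcases hx with rfl | rfl | rfl
          exacts [hi, hj, hlmem.2.2])
        (by rw [hτ, card_eq_three.2 ⟨i, j, l, hij, hlmem.2.1.symm, hlmem.1.symm, rfl⟩])
      ext x
      rw [← h3]
      simp only [mem_erase, mem_insert, mem_singleton]
      constructor
      · tauto
      · rintro (rfl | rfl)
        · exact ⟨hlmem.2.1.symm, by simp⟩
        · exact ⟨hlmem.1.symm, by simp⟩
    beta_reduce at hrow
    rw [hset, Finset.sum_pair hij, hci, zero_div, zero_add] at hrow
    refine (div_eq_zero_iff.1 hrow).resolve_right fun h0 => ?_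
    refine hbsub l hlmem.2.2 j hj hlmem.1 ((ZMod.intCast_zmod_eq_zero_iff_dvd _ _).1 ?_)
    push_cast
    exact h0
  refine ⟨hab, hbsub, fun i hi hdvd => ?_, hnode, hnodesub⟩
  have hcτ := hpair i hi ((ZMod.intCast_zmod_eq_zero_iff_dvd _ _).2 hdvd)
  have hrest := hC (fun i => (c i : ZMod p)) (by
    intro q hq
    have hqτ : q ∉ τ := by simpa using hq
    have h2 := sum_div_zmod_eq_zero p (univ.erase q) c (fun j => a q - a j) (by
      intro j hj
      by_cases hjτ : j ∈ τ
      · intro h0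
        exact hcross j hjτ q hqτ (by rw [← neg_sub]; exact (dvd_neg.2 h0))
      · exact hnodesub q hqτ j hjτ (Finset.ne_of_mem_erase hj).symm) (by
      have := hker q (mem_univ q)
      push_cast
      exact this)
    have haq : ∀ j ∉ τ, (a j : ZMod p) = (((j : ℕ) + 1 : ℤ) : ZMod p) := by
      intro j hj
      rw [← sub_eq_zero, ← Int.cast_sub]
      exact (ZMod.intCast_zmod_eq_zero_iff_dvd _ _).2 (ha j hj)
    refine (Finset.sum_subset_zero_on_sdiff
      (Finset.erase_subset_erase _ (subset_univ _)) ?_ ?_).trans h2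
    · intro j hj
      have hjτ : j ∈ τ := by
        simp only [mem_sdiff, mem_erase, mem_univ, and_true, not_and, mem_compl, not_not] at hj
        exact hj.2 hj.1
      simp [hcτ j hjτ]
    · intro j hj
      have hjτ : j ∉ τ := by simpa using Finset.mem_of_mem_erase hj
      rw [Int.cast_sub, haq j hjτ, haq q hqτ])
  have hall : ∀ j, (p : ℤ) ∣ c j := fun j => by
    rw [← ZMod.intCast_zmod_eq_zero_iff_dvd]
    by_cases hj : j ∈ τ
    · exact hcτ j hj
    · exact hrest j (by simpa using hj)
  have h1 : (p : ℤ) ∣ univ.gcd c := Finset.dvd_gcd fun j _ => hall j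
  rw [hgcd] at h1
  exact hp.one_lt.ne' (by exact_mod_cast Int.eq_one_of_dvd_one (by positivity) h1)

theorem exists_clustered_nodes {N : ℕ} (hN : Odd N) :
    ∃ a c : Fin N → ℤ, IsCauchyKernel (fun i => (a i : ℚ)) (fun i => (c i : ℚ)) univ ∧
      ∀ τ : Finset (Fin N), τ.card = 3 → ∃ (p : ℕ) (b : Fin N → ℤ), p.Prime ∧
        IsCluster a c τ p b := by
  classical
  have hB : ∀ τ : Finset (Fin N), ∃ B : ℕ, τ.card = 3 → ∀ p : ℕ, (hp : p.Prime) → B < p →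
      haveI := Fact.mk hp
      ∀ v : Fin N → ZMod p, IsCauchyKernel (fun i : Fin N => (((i : ℕ) + 1 : ℤ) : ZMod p)) v τᶜ →
        ∀ i ∈ τᶜ, v i = 0 := by
    intro τ
    by_cases hτ : τ.card = 3
    · obtain ⟨B, hB⟩ := exists_forall_prime_cauchyKernel_eq_zero
        (n := fun i : Fin N => ((i : ℕ) + 1 : ℤ)) (s := τᶜ)
        (fun i _ j _ h => Fin.ext (by simpa using h)) (by
          rw [card_compl, hτ, Fintype.card_fin]
          have : 3 ≤ N := by simpa [hτ] using τ.card_le_univ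
          exact Nat.Odd.sub_odd hN (by decide))
      exact ⟨B, fun _ => hB⟩
    · exact ⟨0, fun h => absurd h hτ⟩
  choose B hB using hB
  obtain ⟨p, hpinj, hp⟩ := exists_injective_primes (Finset (Fin N)) (N + ∑ τ, B τ)
  obtain ⟨a, ha⟩ := exists_nodes p hpinj fun τ => (hp τ).1
  obtain ⟨c, hgcd, hker⟩ := exists_primitive_cauchyKernel (by simpa using hN)
    (fun i => (a i : ℤ))
  refine ⟨fun i => a i, c, hker, fun τ hτ => ?_⟩
  have hdvd : ∀ i, ((p τ : ℤ) ^ 2) ∣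
      (if i ∈ τ then (p τ : ℤ) * (i : ℕ) else (i : ℕ) + 1) - a i := by
    intro i
    have := (Nat.modEq_iff_dvd.1 (ha τ i))
    push_cast at this
    convert this using 2
  have hp0 : (p τ : ℤ) ≠ 0 := by exact_mod_cast (hp τ).1.ne_zero
  have hb : ∀ i, ∃ b : ℤ, i ∈ τ → (a i : ℤ) = p τ * b ∧ (p τ : ℤ) ∣ b - (i : ℕ) := by
    intro i
    by_cases hi : i ∈ τ
    · obtain ⟨e, he⟩ := hdvd i
      rw [if_pos hi] at he
      refine ⟨(i : ℕ) - p τ * e, fun _ => ⟨by linear_combination -he, ⟨-e, by ring⟩⟩⟩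
    · exact ⟨0, fun h => absurd h hi⟩
  choose b hb using hb
  refine ⟨p τ, b, (hp τ).1, isCluster_of_modEq hgcd hker hτ (hp τ).1 ?_ ?_
    (fun i hi => (hb i hi).1) (fun i hi => (hb i hi).2) fun i hi => ?_⟩
  · have := (hp τ).2
    omega
  · refine hB τ hτ (p τ) (hp τ).1 ?_
    have h1 := (hp τ).2
    have h2 : B τ ≤ ∑ τ, B τ := Finset.single_le_sum (fun _ _ => Nat.zero_le _) (mem_univ τ)
    omega
  · have := hdvd i
    rw [if_neg hi] at this
    rw [← dvd_neg, neg_sub]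
    exact (dvd_pow_self _ two_ne_zero).trans this

section HenselPowerSeries

variable {A : Type*} [CommRing A]

theorem PowerSeries.constantCoeff_eval (P : (PowerSeries A)[X]) (x : PowerSeries A) :
    PowerSeries.constantCoeff (P.eval x) =
      (P.map PowerSeries.constantCoeff).eval (PowerSeries.constantCoeff x) := by
  rw [eval_map, eval₂_at_apply]

/-- Hensel's lemma for power series, for polynomials that need not be monic. -/
theorem PowerSeries.exists_root_of_isUnit_derivative (P : (PowerSeries A)[X]) (a : A)
    (h0 : (P.map PowerSeries.constantCoeff).eval a = 0)
    (h1 : IsUnit ((P.map PowerSeries.constantCoeff).derivative.eval a)) :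
    ∃ x : PowerSeries A, PowerSeries.constantCoeff x = a ∧ P.eval x = 0 := by
  obtain ⟨u, hu⟩ := h1.exists_right_inv
  let step : PowerSeries A → PowerSeries A := fun x => x - PowerSeries.C u * P.eval x
  let x : ℕ → PowerSeries A := fun n => step^[n] (PowerSeries.C a)
  have hxs : ∀ n, x (n + 1) = x n - PowerSeries.C u * P.eval (x n) := fun n => by
    simp only [x, Function.iterate_succ_apply', step]
  have hmain : ∀ n, PowerSeries.constantCoeff (x n) = a ∧
      (PowerSeries.X : PowerSeries A) ^ (n + 1) ∣ P.eval (x n) := by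
    intro n
    induction n with
    | zero =>
      have hc : PowerSeries.constantCoeff (x 0) = a := PowerSeries.constantCoeff_C a
      refine ⟨hc, ?_⟩
      rw [zero_add, pow_one, PowerSeries.X_dvd_iff, PowerSeries.constantCoeff_eval, hc, h0]
    | succ n ih =>
      obtain ⟨hc, hd⟩ := ih
      have hP0 : PowerSeries.constantCoeff (P.eval (x n)) = 0 := by
        rw [PowerSeries.constantCoeff_eval, hc, h0]
      refine ⟨by rw [hxs, map_sub, map_mul, hP0, hc, mul_zero, sub_zero], ?_⟩
      obtain ⟨k, hk⟩ := P.binomExpansion (x n) (-(PowerSeries.C u * P.eval (x n)))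
      rw [hxs, sub_eq_add_neg, hk]
      have hX : (PowerSeries.X : PowerSeries A) ∣
          1 - P.derivative.eval (x n) * PowerSeries.C u := by
        rw [PowerSeries.X_dvd_iff, map_sub, map_mul, PowerSeries.constantCoeff_eval, hc,
          ← derivative_map, PowerSeries.constantCoeff_C, map_one, hu, sub_self]
      have e : P.eval (x n) + P.derivative.eval (x n) * -(PowerSeries.C u * P.eval (x n)) +
          k * (-(PowerSeries.C u * P.eval (x n))) ^ 2 =
          P.eval (x n) * (1 - P.derivative.eval (x n) * PowerSeries.C u) +
          P.eval (x n) * P.eval (x n) * (k * PowerSeries.C u ^ 2) := by ring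
      rw [e, pow_succ _ (n + 1)]
      refine dvd_add (mul_dvd_mul hd hX) (Dvd.dvd.mul_right ?_ _)
      refine mul_dvd_mul hd ?_
      rwa [PowerSeries.X_dvd_iff]
  have hstep : ∀ n j, j ≤ n → PowerSeries.coeff j (x (n + 1)) = PowerSeries.coeff j (x n) := by
    intro n j hj
    rw [hxs, map_sub, PowerSeries.X_pow_dvd_iff.1 ((hmain n).2.mul_left (PowerSeries.C u)) j
      (by omega), sub_zero]
  have hstab : ∀ n j, j ≤ n → PowerSeries.coeff j (x n) = PowerSeries.coeff j (x j) := by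
    intro n j hj
    induction n, hj using Nat.le_induction with
    | base => rfl
    | succ n hn ih => rw [hstep n j hn, ih]
  let y : PowerSeries A := PowerSeries.mk fun j => PowerSeries.coeff j (x j)
  have hy : ∀ n, (PowerSeries.X : PowerSeries A) ^ (n + 1) ∣ y - x n := by
    intro n
    rw [PowerSeries.X_pow_dvd_iff]
    intro j hj
    rw [map_sub, PowerSeries.coeff_mk, hstab n j (by omega), sub_self]
  refine ⟨y, ?_, ?_⟩
  · rw [← PowerSeries.coeff_zero_eq_constantCoeff_apply, PowerSeries.coeff_mk,
      PowerSeries.coeff_zero_eq_constantCoeff_apply, (hmain 0).1]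
  · ext n
    have h2 := (hy n).trans (sub_dvd_eval_sub y (x n) P)
    have h3 := dvd_add h2 (hmain n).2
    rw [sub_add_cancel] at h3
    rw [PowerSeries.X_pow_dvd_iff.1 h3 n (by omega), map_zero]

theorem PowerSeries.eq_of_constantCoeff_eq_of_root [IsDomain A] (P : (PowerSeries A)[X])
    {x y : PowerSeries A} (hxy : PowerSeries.constantCoeff x = PowerSeries.constantCoeff y)
    (hx : P.eval x = 0) (hy : P.eval y = 0)
    (h1 : (P.map PowerSeries.constantCoeff).derivative.eval (PowerSeries.constantCoeff y) ≠ 0) :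
    x = y := by
  obtain ⟨k, hk⟩ := P.binomExpansion y (x - y)
  rw [add_sub_cancel, hx, hy, zero_add] at hk
  have hk' : (x - y) * (P.derivative.eval y + k * (x - y)) = 0 := by linear_combination -hk
  rcases mul_eq_zero.1 hk' with h | h
  · exact sub_eq_zero.1 h
  · refine absurd ?_ h1
    have := congrArg PowerSeries.constantCoeff h
    rwa [map_add, map_mul, map_sub, hxy, sub_self, mul_zero, add_zero, map_zero,
      PowerSeries.constantCoeff_eval, ← derivative_map] at this

end HenselPowerSeries

section NodePolynomials

set_option linter.unusedSectionVars false

variable {ι B B' : Type*} [DecidableEq ι] [CommRing B] [CommRing B']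

/-- The product of the differences `x - a i`, `i ∈ s`. -/
def nodeProd (s : Finset ι) (a : ι → B) (x : B) : B := ∏ i ∈ s, (x - a i)

/-- The sum of the products of the differences `x - a j`, `j ≠ i`, weighted by `c i ^ 2`. -/
def weightSum (s : Finset ι) (a c : ι → B) (x : B) : B :=
  ∑ i ∈ s, c i ^ 2 * nodeProd (s.erase i) a x

theorem map_nodeProd (φ : B →+* B') (s : Finset ι) (a : ι → B) (x : B) :
    φ (nodeProd s a x) = nodeProd s (fun i => φ (a i)) (φ x) := by
  simp [nodeProd, map_prod]

theorem map_weightSum (φ : B →+* B') (s : Finset ι) (a c : ι → B) (x : B) :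
    φ (weightSum s a c x) = weightSum s (fun i => φ (a i)) (fun i => φ (c i)) (φ x) := by
  simp [weightSum, map_sum, map_nodeProd]

theorem weightSum_apply_node (s : Finset ι) (a c : ι → B) {i : ι} (hi : i ∈ s) :
    weightSum s a c (a i) = c i ^ 2 * nodeProd (s.erase i) a (a i) := by
  rw [weightSum, Finset.sum_eq_single_of_mem i hi]
  intro j _ hji
  rw [nodeProd, Finset.prod_eq_zero (Finset.mem_erase.2 ⟨hji.symm, hi⟩) (sub_self _), mul_zero]

theorem nodeProd_apply_node (s : Finset ι) (a : ι → B) {i : ι} (hi : i ∈ s) :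
    nodeProd s a (a i) = 0 :=
  Finset.prod_eq_zero hi (sub_self _)

/-- The polynomial `∏ (X - a i)`. -/
noncomputable def nodePoly (s : Finset ι) (a : ι → B) : B[X] := nodeProd s (fun i => C (a i)) X

/-- The polynomial `∑ c i ^ 2 * ∏ (X - a j)`, the product being over `j ≠ i`. -/
noncomputable def weightPoly (s : Finset ι) (a c : ι → B) : B[X] :=
  weightSum s (fun i => C (a i)) (fun i => C (c i)) X

@[simp]
theorem eval_nodePoly (s : Finset ι) (a : ι → B) (x : B) :
    (nodePoly s a).eval x = nodeProd s a x := by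
  rw [nodePoly, ← coe_evalRingHom, map_nodeProd]
  simp

@[simp]
theorem eval_weightPoly (s : Finset ι) (a c : ι → B) (x : B) :
    (weightPoly s a c).eval x = weightSum s a c x := by
  rw [weightPoly, ← coe_evalRingHom, map_weightSum]
  simp

theorem map_nodePoly (φ : B →+* B') (s : Finset ι) (a : ι → B) :
    (nodePoly s a).map φ = nodePoly s (fun i => φ (a i)) := by
  rw [nodePoly, ← coe_mapRingHom, map_nodeProd, nodePoly]
  simp

theorem map_weightPoly (φ : B →+* B') (s : Finset ι) (a c : ι → B) :
    (weightPoly s a c).map φ = weightPoly s (fun i => φ (a i)) (fun i => φ (c i)) := by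
  rw [weightPoly, ← coe_mapRingHom, map_weightSum, weightPoly]
  simp

theorem eval_derivative_nodePoly (s : Finset ι) (a : ι → B) {i : ι} (hi : i ∈ s) :
    (nodePoly s a).derivative.eval (a i) = nodeProd (s.erase i) a (a i) := by
  have : nodePoly s a = (X - C (a i)) * nodePoly (s.erase i) a :=
    (Finset.mul_prod_erase s _ hi).symm
  rw [this, derivative_mul]
  simp

theorem monic_nodePoly (s : Finset ι) (a : ι → B) : (nodePoly s a).Monic :=
  monic_prod_of_monic _ _ fun _ _ => monic_X_sub_C _

theorem natDegree_nodePoly [Nontrivial B] (s : Finset ι) (a : ι → B) :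
    (nodePoly s a).natDegree = s.card :=
  natDegree_finsetProd_X_sub_C_eq_card _ _

theorem degree_weightPoly_lt [Nontrivial B] (s : Finset ι) (a c : ι → B) :
    (weightPoly s a c).degree < s.card := by
  refine (degree_sum_le _ _).trans_lt ((Finset.sup_lt_iff (WithBot.bot_lt_coe _)).2 fun i hi => ?_)
  rw [← C_pow, ← smul_eq_C_mul]
  refine (degree_smul_le _ _).trans_lt ?_
  change (nodePoly (s.erase i) a).degree < _
  rw [degree_eq_natDegree (monic_nodePoly _ _).ne_zero, natDegree_nodePoly]
  exact_mod_cast Finset.card_erase_lt_of_mem hi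

end NodePolynomials

section NonRational

variable {ι κ : Type*} [DecidableEq ι] [Field κ]

theorem isCoprime_nodePoly_weightPoly {s : Finset ι} {b c : ι → κ} (hb : Set.InjOn b s)
    (hc : ∀ i ∈ s, c i ≠ 0) : IsCoprime (nodePoly s b) (weightPoly s b c) := by
  refine IsCoprime.prod_left fun i hi => ?_
  refine (irreducible_X_sub_C (b i)).coprime_iff_not_dvd.2 fun h => ?_
  rw [dvd_iff_isRoot, IsRoot.def, eval_weightPoly, weightSum_apply_node _ _ _ hi] at h
  rcases mul_eq_zero.1 h with h | h
  · exact hc i hi (pow_eq_zero_iff two_ne_zero |>.1 h)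
  · obtain ⟨j, hj, h⟩ := Finset.prod_eq_zero_iff.1 h
    exact Finset.ne_of_mem_erase hj (hb (Finset.mem_of_mem_erase hj) hi (sub_eq_zero.1 h).symm)

theorem Polynomial.comp_ne_X_mul_comp {f g : κ[X]} (hfg : IsCoprime f g) (hf : 1 < f.natDegree)
    (u : κ[X]) : f.comp u ≠ X * g.comp u := by
  intro h
  obtain ⟨α, β, hαβ⟩ := hfg
  have hαβ' : α.comp u * f.comp u + β.comp u * g.comp u = 1 := by
    rw [← mul_comp, ← mul_comp, ← add_comp, hαβ, one_comp]
  have hdvd : f.comp u ∣ X := ⟨α.comp u * X + β.comp u, by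
    linear_combination (-X : κ[X]) * hαβ' + β.comp u * (-h)⟩
  have hdeg := natDegree_le_of_dvd hdvd X_ne_zero
  rw [natDegree_comp, natDegree_X] at hdeg
  have hu : u.natDegree = 0 := by
    by_contra h0
    have : f.natDegree * 1 ≤ f.natDegree * u.natDegree :=
      Nat.mul_le_mul_left _ (Nat.one_le_iff_ne_zero.2 h0)
    omega
  obtain ⟨e, rfl⟩ := natDegree_eq_zero.1 hu
  rw [comp_C, comp_C] at h
  have hg0 : g.eval e = 0 := by
    have := congrArg (coeff · 1) h
    simpa using this.symm
  have hf0 : f.eval e = 0 := by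
    have := congrArg (coeff · 0) h
    simpa using this
  simp [comp_C, hg0, hf0] at hαβ'

/-- A power series `y` with `f(y) = X g(y)`, where `f` and `g` are coprime and `f` is monic of
degree at least two, is not a rational function. -/
theorem Polynomial.powerSeries_mul_ne_coe {f g : κ[X]} (hfg : IsCoprime f g) (hm : f.Monic)
    (hf : 1 < f.natDegree) (hdeg : g.degree < f.degree) {y : PowerSeries κ}
    (hy : f.eval₂ PowerSeries.C y = PowerSeries.X * g.eval₂ PowerSeries.C y) {D n : κ[X]}
    (hD : D ≠ 0) : y * D ≠ n := by
  intro h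
  set o := HahnSeries.ofPowerSeries ℤ κ
  set j : κ[X] →+* LaurentSeries κ := o.comp coeToPowerSeries.ringHom
  have ho : Function.Injective o := HahnSeries.ofPowerSeries_injective
  have hj : Function.Injective j := ho.comp (Polynomial.coe_injective κ)
  set e : RatFunc κ →+* LaurentSeries κ := IsFractionRing.lift hj
  have hej : ∀ q, e (algebraMap κ[X] (RatFunc κ) q) = j q := IsFractionRing.lift_algebraMap hj
  set r : RatFunc κ := algebraMap κ[X] (RatFunc κ) n / algebraMap κ[X] (RatFunc κ) D
  have her : e r = o y := by
    rw [map_div₀, hej, hej, div_eq_iff ((map_ne_zero_iff j hj).2 hD)]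
    exact congrArg o h.symm |>.trans (map_mul o y D)
  have hC : e.comp ((algebraMap κ[X] (RatFunc κ)).comp Polynomial.C) = o.comp PowerSeries.C := by
    ext1 a
    simp only [RingHom.comp_apply, hej, j]
    exact congrArg o (Polynomial.coe_C a)
  have hfr : f.eval₂ ((algebraMap κ[X] (RatFunc κ)).comp Polynomial.C) r =
      algebraMap κ[X] (RatFunc κ) Polynomial.X *
        g.eval₂ ((algebraMap κ[X] (RatFunc κ)).comp Polynomial.C) r := by
    refine e.injective ?_
    rw [map_mul, hom_eval₂, hom_eval₂, hC, her, ← hom_eval₂, ← hom_eval₂, hej, hy, map_mul]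
    exact congrArg (· * _) (congrArg o (Polynomial.coe_X).symm)
  have h_integral : IsIntegral κ[X] r := by
    refine ⟨f.map Polynomial.C - Polynomial.C Polynomial.X * g.map Polynomial.C,
      (hm.map Polynomial.C).sub_of_left ?_, ?_⟩
    · rw [← smul_eq_C_mul, degree_map]
      exact (degree_smul_le _ _).trans_lt (by rwa [degree_map])
    · rw [eval₂_sub, eval₂_mul, eval₂_C, eval₂_map, eval₂_map, hfr, sub_self]
  obtain ⟨u, hu⟩ := IsIntegrallyClosed.isIntegral_iff.1 h_integral
  refine comp_ne_X_mul_comp hfg hf u (IsFractionRing.injective κ[X] (RatFunc κ) ?_)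
  rw [map_mul, comp, comp, hom_eval₂, hom_eval₂, hu, hfr]

end NonRational

section Cluster

set_option linter.unusedSectionVars false

variable {ι B : Type*} [Fintype ι] [DecidableEq ι] [CommRing B]

theorem nodeProd_union {s t : Finset ι} (h : Disjoint s t) (a : ι → B) (x : B) :
    nodeProd (s ∪ t) a x = nodeProd s a x * nodeProd t a x :=
  Finset.prod_union h

theorem nodeProd_mul_left {s : Finset ι} {a b : ι → B} {π : B} (h : ∀ i ∈ s, a i = π * b i)
    (y : B) : nodeProd s a (π * y) = π ^ s.card * nodeProd s b y := by
  rw [nodeProd, nodeProd, ← Finset.prod_const, ← Finset.prod_mul_distrib]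
  exact Finset.prod_congr rfl fun i hi => by rw [h i hi, mul_sub]

theorem nodeProd_univ_mul_left {τ : Finset ι} (hτ : τ.card = 3) {a b : ι → B} {π : B}
    (h : ∀ i ∈ τ, a i = π * b i) (y : B) :
    nodeProd univ a (π * y) = π ^ 3 * (nodeProd τ b y * nodeProd τᶜ a (π * y)) := by
  rw [← Finset.union_compl τ, nodeProd_union disjoint_compl_right, nodeProd_mul_left h, hτ,
    mul_assoc]

theorem weightSum_univ_mul_left {τ : Finset ι} (hτ : τ.card = 3) {a b : ι → B} {π : B}
    (h : ∀ i ∈ τ, a i = π * b i) (c : ι → B) (y : B) :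
    weightSum univ a c (π * y) = π ^ 2 * (weightSum τ b c y * nodeProd τᶜ a (π * y)) +
      π ^ 3 * (nodeProd τ b y * weightSum τᶜ a c (π * y)) := by
  rw [weightSum, ← Finset.sum_add_sum_compl τ]
  congr 1
  · rw [weightSum, Finset.sum_mul, Finset.mul_sum]
    refine Finset.sum_congr rfl fun i hi => ?_
    have : univ.erase i = τ.erase i ∪ τᶜ := by
      ext j
      simp only [mem_erase, mem_univ, and_true, mem_union, mem_compl]
      constructor
      · tauto
      · rintro (h | h)
        · exact h.1
        · rintro rfl
          exact h hi
    rw [this, nodeProd_union (disjoint_compl_right.mono_left (erase_subset _ _)),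
      nodeProd_mul_left (fun j hj => h j (mem_of_mem_erase hj)), card_erase_of_mem hi, hτ]
    ring
  · rw [weightSum, Finset.mul_sum, Finset.mul_sum]
    refine Finset.sum_congr rfl fun i hi => ?_
    have : univ.erase i = τ ∪ τᶜ.erase i := by
      ext j
      simp only [mem_erase, mem_univ, and_true, mem_union, mem_compl]
      constructor
      · tauto
      · rintro (h | h)
        · rintro rfl
          exact (mem_compl.1 hi) h
        · exact h.1
    rw [this, nodeProd_union (disjoint_compl_right.mono_right (erase_subset _ _)),
      nodeProd_mul_left h, hτ]
    ring

theorem exists_powerSeries_root {A : Type*} [CommRing A] (a c : ι → A) (i : ι)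
    (h : ∀ j, j ≠ i → IsUnit (a i - a j)) :
    ∃ x : PowerSeries A, PowerSeries.constantCoeff x = a i ∧
      nodeProd univ (fun j => PowerSeries.C (a j)) x =
        PowerSeries.X * weightSum univ (fun j => PowerSeries.C (a j))
          (fun j => PowerSeries.C (c j)) x := by
  obtain ⟨x, hx, hPx⟩ := PowerSeries.exists_root_of_isUnit_derivative
    (nodePoly univ (fun j => PowerSeries.C (a j)) - C PowerSeries.X *
      weightPoly univ (fun j => PowerSeries.C (a j)) (fun j => PowerSeries.C (c j))) (a i)
    (by
      rw [Polynomial.map_sub, Polynomial.map_mul, map_C, map_nodePoly]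
      simp [nodeProd_apply_node univ a (mem_univ i)])
    (by
      rw [Polynomial.map_sub, Polynomial.map_mul, map_C, map_nodePoly]
      simp only [PowerSeries.constantCoeff_C, PowerSeries.constantCoeff_X, C_0, zero_mul, sub_zero]
      rw [eval_derivative_nodePoly _ _ (mem_univ i)]
      exact (IsUnit.prod_iff).2 fun j hj => h j (ne_of_mem_erase hj))
  refine ⟨x, hx, ?_⟩
  rw [eval_sub, eval_mul, eval_C, eval_nodePoly, eval_weightPoly] at hPx
  exact sub_eq_zero.1 hPx

theorem powerSeries_root_unique {A : Type*} [CommRing A] [IsDomain A] (a c : ι → A) (i : ι)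
    (h : ∀ j, j ≠ i → a i ≠ a j) {x y : PowerSeries A}
    (hx0 : PowerSeries.constantCoeff x = a i) (hy0 : PowerSeries.constantCoeff y = a i)
    (hx : nodeProd univ (fun j => PowerSeries.C (a j)) x =
        PowerSeries.X * weightSum univ (fun j => PowerSeries.C (a j))
          (fun j => PowerSeries.C (c j)) x)
    (hy : nodeProd univ (fun j => PowerSeries.C (a j)) y =
        PowerSeries.X * weightSum univ (fun j => PowerSeries.C (a j))
          (fun j => PowerSeries.C (c j)) y) : x = y := by
  refine PowerSeries.eq_of_constantCoeff_eq_of_root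
    (nodePoly univ (fun j => PowerSeries.C (a j)) - C PowerSeries.X *
      weightPoly univ (fun j => PowerSeries.C (a j)) (fun j => PowerSeries.C (c j)))
    (hx0.trans hy0.symm) ?_ ?_ ?_
  · rw [eval_sub, eval_mul, eval_C, eval_nodePoly, eval_weightPoly, hx, sub_self]
  · rw [eval_sub, eval_mul, eval_C, eval_nodePoly, eval_weightPoly, hy, sub_self]
  · rw [Polynomial.map_sub, Polynomial.map_mul, map_C, map_nodePoly]
    simp only [PowerSeries.constantCoeff_C, PowerSeries.constantCoeff_X, C_0, zero_mul, sub_zero]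
    rw [hy0, eval_derivative_nodePoly _ _ (mem_univ i)]
    exact Finset.prod_ne_zero_iff.2 fun j hj => sub_ne_zero.2 (h j (ne_of_mem_erase hj))

end Cluster

section Padic

variable {p : ℕ} [hp : Fact p.Prime]

theorem PadicInt.toZMod_eq_zero_iff (x : ℤ_[p]) : PadicInt.toZMod x = 0 ↔ (p : ℤ_[p]) ∣ x := by
  rw [← RingHom.mem_ker, PadicInt.ker_toZMod, PadicInt.maximalIdeal_eq_span_p,
    Ideal.mem_span_singleton]

theorem PadicInt.isUnit_intCast_iff (z : ℤ) : IsUnit (z : ℤ_[p]) ↔ ¬ (p : ℤ) ∣ z := by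
  rw [PadicInt.isUnit_iff, ← PadicInt.norm_intCast_lt_one_iff (p := p)]
  exact ⟨fun h => by rw [h]; exact lt_irrefl _, fun h =>
    le_antisymm (PadicInt.norm_le_one _) (not_lt.1 h)⟩

theorem exists_coe_eq_map_toZMod {e : ℕ} {w w' : PowerSeries ℤ_[p]}
    (h : PowerSeries.C (p : ℤ_[p]) ^ e * w' = PowerSeries.rescale (p : ℤ_[p]) w) :
    ∃ W : (ZMod p)[X], PowerSeries.map PadicInt.toZMod w' = W := by
  refine ⟨PowerSeries.trunc (e + 1) (PowerSeries.map PadicInt.toZMod w'), ?_⟩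
  ext j
  rw [Polynomial.coeff_coe, PowerSeries.coeff_trunc]
  split_ifs with hj
  · rfl
  · rw [PowerSeries.coeff_map, PadicInt.toZMod_eq_zero_iff]
    have h1 := congrArg (PowerSeries.coeff j) h
    rw [← map_pow, PowerSeries.coeff_C_mul, PowerSeries.coeff_rescale] at h1
    obtain ⟨l, rfl⟩ : ∃ l, j = e + (l + 1) := ⟨j - e - 1, by omega⟩
    rw [pow_add, mul_assoc] at h1
    rw [mul_left_cancel₀ (pow_ne_zero e PadicInt.prime_p.ne_zero) h1, pow_succ, mul_assoc]
    exact Dvd.dvd.mul_left (dvd_mul_right _ _) _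

theorem PowerSeries.exists_eq_C_pow_mul {d : PowerSeries ℤ_[p]} (hd : d ≠ 0) :
    ∃ (e : ℕ) (d' : PowerSeries ℤ_[p]), d = PowerSeries.C (p : ℤ_[p]) ^ e * d' ∧
      PowerSeries.map PadicInt.toZMod d' ≠ 0 := by
  have hdvd : ∀ (q : ℤ_[p]) (f : PowerSeries ℤ_[p]),
      (PowerSeries.C q ∣ f ↔ ∀ j, q ∣ PowerSeries.coeff j f) := by
    intro q f
    constructor
    · rintro ⟨g, rfl⟩ j
      exact ⟨_, PowerSeries.coeff_C_mul _ _ _⟩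
    · intro h
      choose g hg using h
      exact ⟨PowerSeries.mk g, by ext j; simp [hg]⟩
  obtain ⟨j, hj⟩ : ∃ j, PowerSeries.coeff j d ≠ 0 := by
    by_contra! h
    exact hd (PowerSeries.ext (by simpa using h))
  have hfin : FiniteMultiplicity (PowerSeries.C (p : ℤ_[p])) d := by
    obtain ⟨n, hn⟩ := FiniteMultiplicity.of_not_isUnit (PadicInt.prime_p (p := p)).not_isUnit hj
    refine ⟨n, fun h => hn ?_⟩
    rw [← map_pow] at h
    exact (hdvd _ _).1 h j
  obtain ⟨d', hd', hnd⟩ := hfin.exists_eq_pow_mul_and_not_dvd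
  refine ⟨_, d', hd', fun h0 => hnd ((hdvd _ _).2 fun j => ?_)⟩
  rw [← PadicInt.toZMod_eq_zero_iff, ← PowerSeries.coeff_map, h0, map_zero]

theorem exists_polynomial_quotient_mod_p {y d n : PowerSeries ℤ_[p]} (hd : d ≠ 0)
    (h : PowerSeries.C (p : ℤ_[p]) * y * PowerSeries.rescale (p : ℤ_[p]) d =
      PowerSeries.rescale (p : ℤ_[p]) n) :
    ∃ D n' : (ZMod p)[X], D ≠ 0 ∧ PowerSeries.map PadicInt.toZMod y * D = n' := by
  have hp0 : (p : ℤ_[p]) ≠ 0 := PadicInt.prime_p.ne_zero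
  obtain ⟨e, d', hd', hne⟩ := PowerSeries.exists_eq_C_pow_mul
    ((map_ne_zero_iff _ (PowerSeries.rescale_injective hp0)).2 hd)
  obtain ⟨D, hD⟩ := exists_coe_eq_map_toZMod hd'.symm
  obtain ⟨n', hn'⟩ := exists_coe_eq_map_toZMod (e := e + 1) (w' := y * d') (w := n) (by
    rw [← h, hd']
    ring)
  refine ⟨D, n', ?_, ?_⟩
  · rintro rfl
    exact hne (by rw [hD, Polynomial.coe_zero])
  · rw [← hn', map_mul, hD]

end Padic

section MestreRoot

variable {ι B B' : Type*} [Fintype ι] [DecidableEq ι] [CommRing B] [CommRing B']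

/-- `x` is a root of `f - t g`, where `f = ∏ (X - a i)` and `g = ∑ c i ^ 2 ∏ (X - a j)`. -/
def IsMestreRoot (a c : ι → ℤ) (t x : B) : Prop :=
  nodeProd univ (fun j => (a j : B)) x =
    t * weightSum univ (fun j => (a j : B)) (fun j => (c j : B)) x

theorem IsMestreRoot.map {a c : ι → ℤ} {t x : B} (h : IsMestreRoot a c t x) (φ : B →+* B') :
    IsMestreRoot a c (φ t) (φ x) := by
  have := congrArg φ h
  simpa [map_nodeProd, map_weightSum, IsMestreRoot] using this

theorem exists_isMestreRoot (A : Type*) [CommRing A] (a c : ι → ℤ) (i : ι)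
    (h : ∀ j, j ≠ i → IsUnit ((a i - a j : ℤ) : A)) :
    ∃ x : PowerSeries A, PowerSeries.constantCoeff x = a i ∧ IsMestreRoot a c PowerSeries.X x := by
  obtain ⟨x, hx0, hx⟩ := exists_powerSeries_root (fun j => (a j : A)) (fun j => (c j : A)) i
    (fun j hj => by simpa using h j hj)
  exact ⟨x, hx0, by simpa [IsMestreRoot] using hx⟩

theorem IsMestreRoot.eq_of_constantCoeff_eq {A : Type*} [CommRing A] [IsDomain A] [CharZero A]
    {a c : ι → ℤ} (ha : Function.Injective a) {i : ι} {x y : PowerSeries A}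
    (hx0 : PowerSeries.constantCoeff x = a i) (hy0 : PowerSeries.constantCoeff y = a i)
    (hx : IsMestreRoot a c PowerSeries.X x) (hy : IsMestreRoot a c PowerSeries.X y) : x = y :=
  powerSeries_root_unique (fun j => (a j : A)) (fun j => (c j : A)) i
    (fun j hj h => hj (ha (Int.cast_injective h)).symm) hx0 hy0
    (by simpa [IsMestreRoot] using hx) (by simpa [IsMestreRoot] using hy)

end MestreRoot

section ClusterRoot

variable {ι : Type*} [Fintype ι] [DecidableEq ι] {p : ℕ} [hp : Fact p.Prime] {a c b : ι → ℤ}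
  {τ : Finset ι}

theorem IsCluster.isUnit_nodeProd (h : IsCluster a c τ p b) (y : ℤ) :
    IsUnit (nodeProd τᶜ (fun j => (a j : ℤ_[p])) (p * y)) := by
  refine IsUnit.prod_iff.2 fun j hj => ?_
  have := (PadicInt.isUnit_intCast_iff (p := p) (p * y - a j)).2 fun hd =>
    h.not_dvd_node j (mem_compl.1 hj) (by simpa using dvd_sub (dvd_mul_right (p : ℤ) y) hd)
  push_cast at this
  exact this

theorem IsCluster.exists_root (h : IsCluster a c τ p b) (hτ : τ.card = 3) {i : ι} (hi : i ∈ τ) :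
    ∃ y : PowerSeries ℤ_[p], PowerSeries.constantCoeff y = b i ∧
      IsMestreRoot a c ((p : PowerSeries ℤ_[p]) * PowerSeries.X) (p * y) ∧
      nodeProd τ (fun j => (b j : PowerSeries (ZMod p))) (PowerSeries.map PadicInt.toZMod y) =
        PowerSeries.X * weightSum τ (fun j => (b j : PowerSeries (ZMod p))) (fun j => c j)
          (PowerSeries.map PadicInt.toZMod y) := by
  let Y : (PowerSeries ℤ_[p])[X] := X
  let P : (PowerSeries ℤ_[p])[X] :=
    (nodeProd τ (fun j => (b j : (PowerSeries ℤ_[p])[X])) Y -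
      C PowerSeries.X * weightSum τ (fun j => (b j : (PowerSeries ℤ_[p])[X])) (fun j => c j) Y) *
      nodeProd τᶜ (fun j => (a j : (PowerSeries ℤ_[p])[X])) (p * Y) -
    (p : (PowerSeries ℤ_[p])[X]) * C PowerSeries.X *
      (nodeProd τ (fun j => (b j : (PowerSeries ℤ_[p])[X])) Y *
      weightSum τᶜ (fun j => (a j : (PowerSeries ℤ_[p])[X])) (fun j => c j) (p * Y))
  have hPmap : P.map PowerSeries.constantCoeff = nodePoly τ (fun j => (b j : ℤ_[p])) *
      nodeProd τᶜ (fun j => (a j : ℤ_[p][X])) ((p : ℤ_[p][X]) * X) := by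
    rw [← coe_mapRingHom]
    simp only [P, Y, map_sub, map_mul, map_nodeProd, map_weightSum, map_intCast, map_natCast]
    simp [nodePoly]
  have heval : ∀ y : ℤ_[p], (nodeProd τᶜ (fun j => (a j : ℤ_[p][X])) ((p : ℤ_[p][X]) * X)).eval y =
      nodeProd τᶜ (fun j => (a j : ℤ_[p])) (p * y) := by
    intro y
    rw [← coe_evalRingHom, map_nodeProd]
    simp
  obtain ⟨y, hy0, hy⟩ := PowerSeries.exists_root_of_isUnit_derivative P (b i)
    (by
      rw [hPmap, eval_mul, eval_nodePoly, nodeProd_apply_node _ (fun j => (b j : ℤ_[p])) hi,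
        zero_mul])
    (by
      rw [hPmap, derivative_mul, eval_add, eval_mul, eval_mul, eval_nodePoly,
        nodeProd_apply_node _ (fun j => (b j : ℤ_[p])) hi, zero_mul, add_zero, heval,
        eval_derivative_nodePoly _ (fun j => (b j : ℤ_[p])) hi]
      refine IsUnit.mul (IsUnit.prod_iff.2 fun j hj => ?_) (h.isUnit_nodeProd _)
      have := (PadicInt.isUnit_intCast_iff (p := p) _).2
        (h.not_dvd_sub i hi j (mem_of_mem_erase hj) (ne_of_mem_erase hj).symm)
      push_cast at this
      exact this)
  have hPy : (nodeProd τ (fun j => (b j : PowerSeries ℤ_[p])) y -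
      PowerSeries.X * weightSum τ (fun j => (b j : PowerSeries ℤ_[p])) (fun j => c j) y) *
      nodeProd τᶜ (fun j => (a j : PowerSeries ℤ_[p])) (p * y) -
    (p : PowerSeries ℤ_[p]) * PowerSeries.X * (nodeProd τ (fun j => (b j : PowerSeries ℤ_[p])) y *
      weightSum τᶜ (fun j => (a j : PowerSeries ℤ_[p])) (fun j => c j) (p * y)) = 0 := by
    rw [← hy, ← coe_evalRingHom]
    simp only [P, Y, map_sub, map_mul, map_nodeProd, map_weightSum, map_intCast, map_natCast]
    simp
  refine ⟨y, hy0, ?_, ?_⟩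
  · have hab : ∀ j ∈ τ, (a j : PowerSeries ℤ_[p]) = p * (b j : PowerSeries ℤ_[p]) :=
      fun j hj => by rw [h.eq_mul j hj]; push_cast; rfl
    rw [IsMestreRoot, nodeProd_univ_mul_left hτ hab, weightSum_univ_mul_left hτ hab]
    linear_combination (p : PowerSeries ℤ_[p]) ^ 3 * hPy
  · have h1 := congrArg (PowerSeries.map (PadicInt.toZMod (p := p))) hPy
    have h0 : (p : PowerSeries (ZMod p)) = 0 := by
      rw [← map_natCast (PowerSeries.C (R := ZMod p)), CharP.cast_eq_zero, map_zero]
    simp only [map_sub, map_mul, map_nodeProd, map_weightSum, map_intCast, map_natCast, h0,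
      zero_mul, sub_zero, PowerSeries.map_X, map_zero] at h1
    refine sub_eq_zero.1 ((mul_eq_zero.1 h1).resolve_right ?_)
    refine Finset.prod_ne_zero_iff.2 fun j hj => ?_
    beta_reduce
    rw [zero_sub, neg_ne_zero, ← map_intCast (PowerSeries.C (R := ZMod p)),
      map_ne_zero_iff _ PowerSeries.C_injective, Ne, ZMod.intCast_zmod_eq_zero_iff_dvd]
    exact h.not_dvd_node j (mem_compl.1 hj)

theorem IsCluster.isMestreRoot_mul_ne (h : IsCluster a c τ p b) (hτ : τ.card = 3)
    (ha : Function.Injective a) {i : ι} (hi : i ∈ τ) {x : PowerSeries ℚ_[p]}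
    (hx0 : PowerSeries.constantCoeff x = a i) (hx : IsMestreRoot a c PowerSeries.X x)
    {d n : PowerSeries ℤ_[p]} (hd : d ≠ 0) :
    x * PowerSeries.map PadicInt.Coe.ringHom d ≠ PowerSeries.map PadicInt.Coe.ringHom n := by
  intro hdn
  obtain ⟨y, hy0, hy, hymod⟩ := h.exists_root hτ hi
  have hp0 : (p : ℚ_[p]) ≠ 0 := by exact_mod_cast hp.out.ne_zero
  have hcomm : ∀ w : PowerSeries ℤ_[p], PowerSeries.map PadicInt.Coe.ringHom
      (PowerSeries.rescale (p : ℤ_[p]) w) =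
      PowerSeries.rescale (p : ℚ_[p]) (PowerSeries.map PadicInt.Coe.ringHom w) := by
    intro w
    ext j
    simp [PowerSeries.coeff_rescale]
  have hxy : x = PowerSeries.rescale (p : ℚ_[p])⁻¹
      (PowerSeries.map PadicInt.Coe.ringHom ((p : PowerSeries ℤ_[p]) * y)) := by
    refine IsMestreRoot.eq_of_constantCoeff_eq ha (i := i) hx0 ?_ hx ?_
    · rw [map_mul, map_mul, map_mul, map_natCast, map_natCast, map_natCast, h.eq_mul i hi]
      rw [← PowerSeries.coeff_zero_eq_constantCoeff_apply, PowerSeries.coeff_rescale,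
        PowerSeries.coeff_map, PowerSeries.coeff_zero_eq_constantCoeff_apply, hy0]
      simp
    · convert (hy.map (PowerSeries.map PadicInt.Coe.ringHom)).map
        (PowerSeries.rescale (p : ℚ_[p])⁻¹) using 1
      rw [map_mul, map_mul, map_natCast, map_natCast, PowerSeries.map_X, PowerSeries.rescale_X,
        ← mul_assoc, ← map_natCast (PowerSeries.C (R := ℚ_[p])), ← map_mul, mul_inv_cancel₀ hp0,
        map_one, one_mul]
  have hresc : PowerSeries.rescale (p : ℚ_[p]) x =
      PowerSeries.map PadicInt.Coe.ringHom ((p : PowerSeries ℤ_[p]) * y) := by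
    rw [hxy, PowerSeries.rescale_rescale, inv_mul_cancel₀ hp0, PowerSeries.rescale_one]
    rfl
  have hmul : PowerSeries.C (p : ℤ_[p]) * y * PowerSeries.rescale (p : ℤ_[p]) d =
      PowerSeries.rescale (p : ℤ_[p]) n := by
    refine PowerSeries.map_injective PadicInt.Coe.ringHom Subtype.val_injective ?_
    rw [hcomm, ← hdn, map_mul, map_mul (PowerSeries.rescale _), hresc, hcomm, map_natCast]
  obtain ⟨D, n', hD, hDn⟩ := exists_polynomial_quotient_mod_p hd hmul
  have hbinj : Set.InjOn (fun j => (b j : ZMod p)) τ := by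
    intro j hj l hl hjl
    by_contra hne
    refine h.not_dvd_sub j hj l hl hne ?_
    rw [← ZMod.intCast_zmod_eq_zero_iff_dvd, Int.cast_sub, sub_eq_zero]
    exact hjl
  refine Polynomial.powerSeries_mul_ne_coe (κ := ZMod p)
    (isCoprime_nodePoly_weightPoly (c := fun j => (c j : ZMod p)) hbinj fun j hj h0 =>
      h.not_dvd_weight j hj ((ZMod.intCast_zmod_eq_zero_iff_dvd _ _).1 h0))
    (monic_nodePoly _ _) (by rw [natDegree_nodePoly, hτ]; norm_num)
    (by
      rw [degree_eq_natDegree (monic_nodePoly _ _).ne_zero, natDegree_nodePoly]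
      exact degree_weightPoly_lt _ _ _) ?_ hD hDn
  rw [← eval_map, ← eval_map, map_nodePoly, map_weightPoly, eval_nodePoly, eval_weightPoly]
  simpa using hymod

/-- The roots at the nodes of a cluster are not quotients of polynomial expressions in the
variable and the other roots. -/
theorem IsCluster.mul_notMem_adjoin (h : IsCluster a c τ p b) (hτ : τ.card = 3)
    (ha : Function.Injective a) {x : ι → PowerSeries ℚ}
    (hx0 : ∀ i, PowerSeries.constantCoeff (x i) = a i)
    (hx : ∀ i, IsMestreRoot a c PowerSeries.X (x i)) {i : ι} (hi : i ∈ τ) {d n : PowerSeries ℚ}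
    (hd : d ∈ Algebra.adjoin ℚ (insert PowerSeries.X (x '' (τ : Set ι)ᶜ)))
    (hn : n ∈ Algebra.adjoin ℚ (insert PowerSeries.X (x '' (τ : Set ι)ᶜ))) (hd0 : d ≠ 0) :
    x i * d ≠ n := by
  set r : PowerSeries ℚ →+* PowerSeries ℚ_[p] := PowerSeries.map (algebraMap ℚ ℚ_[p])
  set j : PowerSeries ℤ_[p] →+* PowerSeries ℚ_[p] := PowerSeries.map PadicInt.Coe.ringHom
  have hr : Function.Injective r := PowerSeries.map_injective _ (algebraMap ℚ ℚ_[p]).injective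
  have hj : Function.Injective j := PowerSeries.map_injective _ Subtype.val_injective
  have hrx0 : ∀ q, PowerSeries.constantCoeff (r (x q)) = a q := fun q => by
    rw [← PowerSeries.coeff_zero_eq_constantCoeff_apply, PowerSeries.coeff_map,
      PowerSeries.coeff_zero_eq_constantCoeff_apply, hx0, map_intCast]
  have hrx : ∀ q, IsMestreRoot a c PowerSeries.X (r (x q)) := fun q => by
    simpa only [r, PowerSeries.map_X] using (hx q).map r
  have h_integral : ∀ z ∈ Algebra.adjoin ℚ (insert PowerSeries.X (x '' (τ : Set ι)ᶜ)),
      ∃ m : ℤ, m ≠ 0 ∧ ∃ w, m * r z = j w := by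
    intro z hz
    induction hz using Algebra.adjoin_induction with
    | mem z hz =>
      refine ⟨1, one_ne_zero, ?_⟩
      rw [Int.cast_one, one_mul]
      rcases hz with rfl | ⟨q, hq, rfl⟩
      · exact ⟨PowerSeries.X, by simp [r, j]⟩
      · have hq' : q ∉ τ := hq
        obtain ⟨w, hw0, hw⟩ := exists_isMestreRoot ℤ_[p] a c q fun l hl => by
          rw [PadicInt.isUnit_intCast_iff]
          by_cases hlτ : l ∈ τ
          · intro hdvd
            refine h.not_dvd_node q hq' ?_
            have := dvd_add hdvd (Dvd.intro _ (h.eq_mul l hlτ).symm)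
            simpa using this
          · exact h.not_dvd_node_sub q hq' l hlτ hl.symm
        refine ⟨w, IsMestreRoot.eq_of_constantCoeff_eq ha (hrx0 q) ?_ (hrx q) ?_⟩
        · rw [← PowerSeries.coeff_zero_eq_constantCoeff_apply, PowerSeries.coeff_map,
            PowerSeries.coeff_zero_eq_constantCoeff_apply, hw0, map_intCast]
        · simpa only [j, PowerSeries.map_X] using hw.map j
    | algebraMap q =>
      refine ⟨q.den, by exact_mod_cast q.den_ne_zero, (q.num : PowerSeries ℤ_[p]), ?_⟩
      have h1 : (q.den : PowerSeries ℚ) * algebraMap ℚ (PowerSeries ℚ) q = q.num := by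
        rw [← map_natCast (algebraMap ℚ (PowerSeries ℚ)), ← map_mul, mul_comm, Rat.mul_den_eq_num,
          map_intCast]
      have h2 := congrArg r h1
      rw [map_mul, map_natCast, map_intCast] at h2
      rw [map_intCast, Int.cast_natCast, h2]
    | add u v _ _ hu hv =>
      obtain ⟨m, hm, w, hw⟩ := hu
      obtain ⟨m', hm', w', hw'⟩ := hv
      refine ⟨m * m', mul_ne_zero hm hm', m' * w + m * w', ?_⟩
      simp only [map_add, map_mul, map_intCast, ← hw, ← hw']
      push_cast
      ring
    | mul u v _ _ hu hv =>
      obtain ⟨m, hm, w, hw⟩ := hu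
      obtain ⟨m', hm', w', hw'⟩ := hv
      refine ⟨m * m', mul_ne_zero hm hm', w * w', ?_⟩
      simp only [map_mul, ← hw, ← hw']
      push_cast
      ring
  intro hdn
  obtain ⟨m, hm, w, hw⟩ := h_integral d hd
  obtain ⟨m', hm', w', hw'⟩ := h_integral n hn
  have hcast : ∀ z : ℤ, z ≠ 0 → (z : PowerSeries ℚ_[p]) ≠ 0 := fun z hz => by
    rw [← map_intCast (PowerSeries.C (R := ℚ_[p])), map_ne_zero_iff _ PowerSeries.C_injective]
    exact_mod_cast hz
  refine h.isMestreRoot_mul_ne hτ ha hi (hrx0 i) (hrx i) (d := m' * w) (n := m * w') ?_ ?_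
  · rw [← map_ne_zero_iff j hj, map_mul, map_intCast, ← hw]
    exact mul_ne_zero (hcast _ hm') (mul_ne_zero (hcast _ hm) ((map_ne_zero_iff r hr).2 hd0))
  · change r (x i) * j (m' * w) = j (m * w')
    rw [map_mul, map_mul, map_intCast, map_intCast, ← hw, ← hw', ← hdn, map_mul]
    ring

end ClusterRoot

section CoefficientFunctional

variable {k : Type*} [Field k] [CharZero k]

/-- Apply a `ℚ`-linear functional to the coefficients of a power series. -/
noncomputable def PowerSeries.mapFunctional (l : k →ₗ[ℚ] ℚ) (z : PowerSeries k) : PowerSeries ℚ :=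
  PowerSeries.mk fun n => l (PowerSeries.coeff n z)

theorem PowerSeries.mapFunctional_map_mul (l : k →ₗ[ℚ] ℚ) (x : PowerSeries ℚ) (z : PowerSeries k) :
    PowerSeries.mapFunctional l (PowerSeries.map (algebraMap ℚ k) x * z) =
      x * PowerSeries.mapFunctional l z := by
  ext n
  simp only [mapFunctional, PowerSeries.coeff_mk, PowerSeries.coeff_mul, map_sum,
    PowerSeries.coeff_map]
  exact Finset.sum_congr rfl fun i _ => by rw [← Algebra.smul_def, map_smul, smul_eq_mul]

theorem PowerSeries.mapFunctional_mem_adjoin {S : Set (PowerSeries ℚ)} {z : PowerSeries k}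
    (hz : z ∈ Algebra.adjoin k (PowerSeries.map (algebraMap ℚ k) '' S)) (l : k →ₗ[ℚ] ℚ) :
    PowerSeries.mapFunctional l z ∈ Algebra.adjoin ℚ S := by
  rw [← Subalgebra.mem_toSubmodule, Algebra.adjoin_eq_span] at hz
  induction hz using Submodule.span_induction generalizing l with
  | mem z hz =>
    obtain ⟨w, hw, rfl⟩ := (MonoidHom.map_mclosure
      (PowerSeries.map (algebraMap ℚ k) : PowerSeries ℚ →* PowerSeries k) S).ge hz
    have : PowerSeries.mapFunctional l (PowerSeries.map (algebraMap ℚ k) w * 1) = l 1 • w := by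
      rw [PowerSeries.mapFunctional_map_mul, mul_comm, PowerSeries.smul_eq_C_mul]
      congr 1
      ext n
      rw [mapFunctional, PowerSeries.coeff_mk, PowerSeries.coeff_one, PowerSeries.coeff_C]
      split_ifs <;> simp
    rw [mul_one] at this
    change PowerSeries.mapFunctional l (PowerSeries.map (algebraMap ℚ k) w) ∈ _
    rw [this]
    refine Subalgebra.smul_mem _ ?_ _
    have hle : Submonoid.closure S ≤ (Algebra.adjoin ℚ S).toSubmonoid :=
      Submonoid.closure_le.2 Algebra.subset_adjoin
    exact hle hw
  | zero =>
    have : PowerSeries.mapFunctional l (0 : PowerSeries k) = 0 := by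
      ext n
      simp [mapFunctional]
    rw [this]
    exact zero_mem _
  | add u v _ _ hu hv =>
    have : PowerSeries.mapFunctional l (u + v) =
        PowerSeries.mapFunctional l u + PowerSeries.mapFunctional l v := by
      ext n
      simp [mapFunctional]
    rw [this]
    exact add_mem (hu l) (hv l)
  | smul c u _ hu =>
    have : PowerSeries.mapFunctional l (c • u) =
        PowerSeries.mapFunctional (l ∘ₗ LinearMap.mulLeft ℚ c) u := by
      ext n
      simp [mapFunctional]
    rw [this]
    exact hu _

/-- A power series over `ℚ` which is not a quotient of elements of `ℚ[S]` is not in the field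
generated by `S` over any extension of `ℚ`. -/
theorem LaurentSeries.coe_map_notMem_adjoin {S : Set (PowerSeries ℚ)} {x : PowerSeries ℚ}
    (hx : ∀ d ∈ Algebra.adjoin ℚ S, ∀ n ∈ Algebra.adjoin ℚ S, d ≠ 0 → x * d ≠ n) :
    HahnSeries.ofPowerSeries ℤ k (PowerSeries.map (algebraMap ℚ k) x) ∉
      IntermediateField.adjoin k ((fun z => HahnSeries.ofPowerSeries ℤ k
        (PowerSeries.map (algebraMap ℚ k) z)) '' S) := by
  intro hmem
  set o : PowerSeries k →ₐ[k] LaurentSeries k :=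
    { HahnSeries.ofPowerSeries ℤ k with commutes' := fun _ => rfl }
  have ho : Function.Injective o := HahnSeries.ofPowerSeries_injective
  have hadj : ∀ z ∈ Algebra.adjoin k ((fun z => HahnSeries.ofPowerSeries ℤ k
        (PowerSeries.map (algebraMap ℚ k) z)) '' S),
      ∃ w ∈ Algebra.adjoin k (PowerSeries.map (algebraMap ℚ k) '' S), o w = z := by
    intro z hz
    have himg : (fun z => HahnSeries.ofPowerSeries ℤ k (PowerSeries.map (algebraMap ℚ k) z)) '' S =
        o '' (PowerSeries.map (algebraMap ℚ k) '' S) := by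
      rw [Set.image_image]
      rfl
    rw [himg, ← AlgHom.map_adjoin] at hz
    exact hz
  obtain ⟨r, hr, s, hs, hrs⟩ := IntermediateField.mem_adjoin_iff_div.1 hmem
  obtain ⟨n, hn, d, hd, hd0, hnd⟩ : ∃ n ∈ Algebra.adjoin k (PowerSeries.map (algebraMap ℚ k) '' S),
      ∃ d ∈ Algebra.adjoin k (PowerSeries.map (algebraMap ℚ k) '' S), d ≠ 0 ∧
        PowerSeries.map (algebraMap ℚ k) x * d = n := by
    obtain ⟨n, hn, rfl⟩ := hadj r hr
    obtain ⟨d, hd, rfl⟩ := hadj s hs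
    by_cases hd0 : d = 0
    · rw [hd0, map_zero, div_zero] at hrs
      refine ⟨0, zero_mem _, 1, one_mem _, one_ne_zero, ?_⟩
      rw [mul_one]
      exact ho (hrs.trans (map_zero o).symm)
    · refine ⟨n, hn, d, hd, hd0, ho ?_⟩
      rw [map_mul]
      exact (eq_div_iff ((map_ne_zero_iff o ho).2 hd0)).1 hrs
  obtain ⟨j, hj⟩ : ∃ j, PowerSeries.coeff j d ≠ 0 := by
    by_contra! h
    exact hd0 (PowerSeries.ext (by simpa using h))
  obtain ⟨l, hl⟩ : ∃ l : k →ₗ[ℚ] ℚ, l (PowerSeries.coeff j d) ≠ 0 := by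
    by_contra! h
    exact hj ((Module.forall_dual_apply_eq_zero_iff ℚ _).1 h)
  refine hx _ (PowerSeries.mapFunctional_mem_adjoin hd l) _
    (PowerSeries.mapFunctional_mem_adjoin hn l) (fun h0 => hl ?_)
    (by rw [← hnd, PowerSeries.mapFunctional_map_mul])
  have := congrArg (PowerSeries.coeff j) h0
  simpa [PowerSeries.mapFunctional] using this

end CoefficientFunctional

theorem IsCluster.weight_ne_zero {ι : Type*} {a c b : ι → ℤ} {τ : Finset ι} {p : ℕ}
    (h : IsCluster a c τ p b) {i : ι} (hi : i ∈ τ) : c i ≠ 0 := fun h0 =>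
  h.not_dvd_weight i hi (h0 ▸ dvd_zero _)

theorem IsCluster.node_ne {ι : Type*} {a c b : ι → ℤ} {τ : Finset ι} {p : ℕ} (hp : p.Prime)
    (h : IsCluster a c τ p b) {i j : ι} (hi : i ∈ τ) (hj : j ∈ τ) (hij : i ≠ j) : a i ≠ a j := by
  intro h0
  rw [h.eq_mul i hi, h.eq_mul j hj] at h0
  have := mul_left_cancel₀ (by exact_mod_cast hp.ne_zero) h0
  exact h.not_dvd_sub i hi j hj hij (by simp [this])

/-- Existence of nodes and weights whose roots in Laurent series satisfy the independence property
that forces the Galois group to contain all cycles of length three. -/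
theorem exists_laurentSeries_mestreRoots (k : Type*) [Field k] [CharZero k] {N : ℕ} (hN : Odd N)
    (hN3 : 3 ≤ N) :
    ∃ a c : Fin N → ℤ, Function.Injective a ∧ (∀ i, c i ≠ 0) ∧
      IsCauchyKernel (fun i => (a i : ℚ)) (fun i => (c i : ℚ)) univ ∧
      ∃ x : Fin N → LaurentSeries k, Function.Injective x ∧
        (∀ i, IsMestreRoot a c (HahnSeries.single 1 1 : LaurentSeries k) (x i)) ∧
        ∀ τ : Finset (Fin N), τ.card = 3 → ∀ i ∈ τ, x i ∉ IntermediateField.adjoin k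
          (insert (HahnSeries.single 1 1 : LaurentSeries k) (x '' (τ : Set (Fin N))ᶜ)) := by
  obtain ⟨a, c, hker, hcl⟩ := exists_clustered_nodes hN
  have hsup : ∀ s : Finset (Fin N), s.card ≤ 2 → ∃ τ : Finset (Fin N), s ⊆ τ ∧ τ.card = 3 :=
    fun s hs => Finset.exists_superset_card_eq (by omega) (by simpa using hN3)
  have ha : Function.Injective a := by
    intro i j hij
    by_contra hne
    obtain ⟨τ, hs, hτ⟩ := hsup {i, j} Finset.card_le_two
    obtain ⟨p, b, hp, h⟩ := hcl τ hτ
    exact h.node_ne hp (hs (by simp)) (hs (by simp)) hne hij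
  have hc : ∀ i, c i ≠ 0 := by
    intro i
    obtain ⟨τ, hs, hτ⟩ := hsup {i} (by simp)
    obtain ⟨p, b, hp, h⟩ := hcl τ hτ
    exact h.weight_ne_zero (hs (by simp))
  have hroot : ∀ i, ∃ x : PowerSeries ℚ, PowerSeries.constantCoeff x = a i ∧
      IsMestreRoot a c PowerSeries.X x := fun i =>
    exists_isMestreRoot ℚ a c i fun j hj => by
      rw [isUnit_iff_ne_zero, Int.cast_ne_zero, sub_ne_zero]
      exact ha.ne hj.symm
  choose x hx0 hx using hroot
  obtain ⟨e, he⟩ : ∃ e : PowerSeries ℚ →+* LaurentSeries k,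
      ∀ z, e z = HahnSeries.ofPowerSeries ℤ k (PowerSeries.map (algebraMap ℚ k) z) :=
    ⟨(HahnSeries.ofPowerSeries ℤ k).comp (PowerSeries.map (algebraMap ℚ k)), fun _ => rfl⟩
  have heinj : Function.Injective e := fun y z hyz =>
    PowerSeries.map_injective _ (algebraMap ℚ k).injective
      (HahnSeries.ofPowerSeries_injective ((he y).symm.trans (hyz.trans (he z))))
  have heX : e PowerSeries.X = HahnSeries.single 1 1 := by
    rw [he, PowerSeries.map_X, HahnSeries.ofPowerSeries_X]
  refine ⟨a, c, ha, hc, hker, fun i => e (x i), ?_, fun i => ?_, fun τ hτ i hi => ?_⟩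
  · intro i j hij
    have := congrArg PowerSeries.constantCoeff (heinj hij)
    rw [hx0, hx0] at this
    exact ha (by exact_mod_cast this)
  · rw [← heX]
    exact (hx i).map e
  · obtain ⟨p, b, hp, h⟩ := hcl τ hτ
    have := Fact.mk hp
    have hnot := LaurentSeries.coe_map_notMem_adjoin (k := k)
      (S := insert PowerSeries.X (x '' (τ : Set (Fin N))ᶜ)) (x := x i)
      (fun d hd n hn => h.mul_notMem_adjoin hτ ha hx0 hx hi hd hn)
    simp only [← he] at hnot
    rw [Set.image_insert_eq, Set.image_image, heX] at hnot
    exact hnot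

section Discriminant

variable {ι K : Type*} [Fintype ι] [DecidableEq ι] [Field K]

theorem nodePoly_eq_mul_erase (a : ι → K) (i : ι) :
    nodePoly univ a = (X - C (a i)) * nodePoly (univ.erase i) a :=
  (Finset.mul_prod_erase univ _ (mem_univ i)).symm

theorem weightSum_eq_mul_sum {a c : ι → K} {x : K} (hx : ∀ i, x - a i ≠ 0) :
    weightSum univ a c x = nodeProd univ a x * ∑ i, c i ^ 2 / (x - a i) := by
  rw [weightSum, Finset.mul_sum]
  refine Finset.sum_congr rfl fun i _ => ?_
  rw [nodeProd, nodeProd, ← Finset.mul_prod_erase univ _ (mem_univ i)]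
  field_simp [hx i]

theorem eval_derivative_weightPoly {a c : ι → K} {x : K} (hx : ∀ i, x - a i ≠ 0) :
    (weightPoly univ a c).derivative.eval x =
      (nodePoly univ a).derivative.eval x * ∑ i, c i ^ 2 / (x - a i) -
        nodeProd univ a x * ∑ i, c i ^ 2 / (x - a i) ^ 2 := by
  have hw : weightPoly univ a c = ∑ i, C (c i ^ 2) * nodePoly (univ.erase i) a := by
    simp [weightPoly, weightSum, nodePoly]
  rw [hw, derivative_sum, eval_finsetSum, Finset.mul_sum, Finset.mul_sum,
    ← Finset.sum_sub_distrib]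
  refine Finset.sum_congr rfl fun i _ => ?_
  rw [← eval_nodePoly, nodePoly_eq_mul_erase a i, derivative_C_mul, derivative_mul]
  have := hx i
  simp only [derivative_sub, derivative_X, derivative_C, eval_add, eval_mul, eval_sub, eval_X,
    eval_C, sub_zero, one_mul]
  field_simp
  ring

theorem eval_derivative_nodePoly_sub_mul_weightPoly {a c : ι → K} {t x : K}
    (hker : IsCauchyKernel a c univ) (ha : Function.Injective a) (hx : ∀ i, x - a i ≠ 0)
    (hroot : nodeProd univ a x = t * weightSum univ a c x) :
    (nodePoly univ a - C t * weightPoly univ a c).derivative.eval x =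
      t * nodeProd univ a x * (∑ i, c i / (x - a i)) ^ 2 := by
  have hf : nodeProd univ a x ≠ 0 := Finset.prod_ne_zero_iff.2 fun i _ => hx i
  rw [weightSum_eq_mul_sum hx] at hroot
  have h1 : t * ∑ i, c i ^ 2 / (x - a i) = 1 :=
    mul_left_cancel₀ hf (by linear_combination -hroot)
  rw [derivative_sub, derivative_C_mul, eval_sub, eval_mul, eval_C, eval_derivative_weightPoly hx,
    hker.sq_sum_div ha.injOn fun i _ => hx i]
  linear_combination -(nodePoly univ a).derivative.eval x * h1

/-- The polynomial `f - t g` splits once it has enough roots. -/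
theorem nodePoly_eq_of_roots {a c x : ι → K} {t : K} (hx : Function.Injective x)
    (hroot : ∀ i, nodeProd univ a (x i) = t * weightSum univ a c (x i)) :
    nodePoly univ x = nodePoly univ a - C t * weightPoly univ a c := by
  have hdeg : (C t * weightPoly univ a c).degree < (nodePoly univ a).degree := by
    refine lt_of_le_of_lt (smul_eq_C_mul (R := K) t ▸ degree_smul_le t _) ?_
    rw [degree_eq_natDegree (monic_nodePoly _ _).ne_zero, natDegree_nodePoly]
    exact degree_weightPoly_lt _ _ _
  refine (eq_of_monic_of_dvd_of_natDegree_le (monic_nodePoly _ _)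
    ((monic_nodePoly _ _).sub_of_left hdeg) ?_ ?_).symm
  · refine Finset.prod_dvd_of_coprime (fun i _ j _ hij => ?_) fun i _ => ?_
    · exact pairwise_coprime_X_sub_C hx hij
    · rw [dvd_iff_isRoot, IsRoot.def, eval_sub, eval_mul, eval_C, eval_nodePoly, eval_weightPoly,
        hroot, sub_self]
  · rw [natDegree_eq_of_degree_eq (degree_sub_eq_left_of_degree_lt hdeg), natDegree_nodePoly,
      natDegree_nodePoly]

variable {a c x : ι → K} {t : K}

theorem root_sub_node_ne_zero (ha : Function.Injective a) (hc : ∀ i, c i ≠ 0) (ht : t ≠ 0) {y : K}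
    (hroot : nodeProd univ a y = t * weightSum univ a c y) (i : ι) : y - a i ≠ 0 := by
  intro h
  rw [sub_eq_zero] at h
  rw [h, nodeProd_apply_node _ _ (mem_univ i), weightSum_apply_node _ _ _ (mem_univ i)] at hroot
  refine mul_ne_zero ht (mul_ne_zero (pow_ne_zero 2 (hc i)) ?_) hroot.symm
  exact Finset.prod_ne_zero_iff.2 fun j hj => sub_ne_zero.2 (ha.ne (ne_of_mem_erase hj).symm)

theorem prod_nodeProd_roots (hx : Function.Injective x)
    (hroot : ∀ i, nodeProd univ a (x i) = t * weightSum univ a c (x i)) :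
    ∏ i, nodeProd univ a (x i) =
      ∏ i, (t * (c i ^ 2 * nodeProd (univ.erase i) a (a i))) := by
  have h : ∀ j, ∏ i, (x i - a j) = (-1) ^ Fintype.card ι * nodeProd univ x (a j) := fun j => by
    rw [nodeProd, ← Finset.card_univ, ← Finset.prod_const, ← Finset.prod_mul_distrib]
    exact Finset.prod_congr rfl fun i _ => by ring
  simp only [nodeProd] at h ⊢
  rw [Finset.prod_comm]
  simp only [h]
  have h2 : ∀ j, (-1) ^ Fintype.card ι * ∏ i, (a j - x i) =
      (-1) ^ (Fintype.card ι + 1) * (t * (c j ^ 2 * ∏ i ∈ univ.erase j, (a j - a i))) := fun j => by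
    have := congrArg (eval (a j)) (nodePoly_eq_of_roots hx hroot)
    rw [eval_sub, eval_mul, eval_C, eval_nodePoly, eval_nodePoly, eval_weightPoly,
      nodeProd_apply_node _ _ (mem_univ j), weightSum_apply_node _ _ _ (mem_univ j)] at this
    simp only [nodeProd] at this
    rw [this, pow_succ]
    ring
  rw [Finset.prod_congr rfl fun j _ => h2 j, Finset.prod_mul_distrib, Finset.prod_const,
    Finset.card_univ, ← pow_mul, Even.neg_one_pow, one_mul]
  rw [mul_comm]
  exact Nat.even_mul_succ_self _

theorem prod_nodeProd_erase_roots (hker : IsCauchyKernel a c univ) (ha : Function.Injective a)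
    (hc : ∀ i, c i ≠ 0) (ht : t ≠ 0) (hx : Function.Injective x)
    (hroot : ∀ i, nodeProd univ a (x i) = t * weightSum univ a c (x i)) :
    ∏ i, nodeProd (univ.erase i) x (x i) =
      (∏ i, (t * c i * ∑ l, c l / (x i - a l))) ^ 2 * ∏ i, nodeProd (univ.erase i) a (a i) := by
  have h : ∀ i, nodeProd (univ.erase i) x (x i) =
      t * nodeProd univ a (x i) * (∑ l, c l / (x i - a l)) ^ 2 := fun i => by
    rw [← eval_derivative_nodePoly_sub_mul_weightPoly hker ha
      (root_sub_node_ne_zero ha hc ht (hroot i)) (hroot i), ← nodePoly_eq_of_roots hx hroot,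
      eval_derivative_nodePoly _ _ (mem_univ i)]
  rw [Finset.prod_congr rfl fun i _ => h i, Finset.prod_mul_distrib, Finset.prod_mul_distrib,
    prod_nodeProd_roots hx hroot, ← Finset.prod_pow, ← Finset.prod_mul_distrib,
    ← Finset.prod_mul_distrib, ← Finset.prod_mul_distrib]
  exact Finset.prod_congr rfl fun i _ => by ring

end Discriminant

section Vandermonde

variable {K : Type*} [Field K] {N : ℕ}

theorem prod_nodeProd_erase_eq_det_sq (v : Fin N → K) :
    ∏ i, nodeProd (univ.erase i) v (v i) =
      (∏ i : Fin N, ∏ _j ∈ Ioi i, (-1)) * (Matrix.vandermonde v).det ^ 2 := by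
  have hsplit : ∀ i : Fin N, univ.erase i = Ioi i ∪ Iio i := fun i => by
    ext j
    simp only [mem_erase, mem_univ, and_true, mem_union, mem_Ioi, mem_Iio]
    rw [ne_iff_lt_or_gt, or_comm]
  have hdisj : ∀ i : Fin N, Disjoint (Ioi i) (Iio i) := fun i =>
    Finset.disjoint_left.2 fun j hj hj' => lt_asymm (mem_Ioi.1 hj) (mem_Iio.1 hj')
  have hcomm : ∏ i, ∏ j ∈ Iio i, (v i - v j) = ∏ i, ∏ j ∈ Ioi i, (v j - v i) :=
    Finset.prod_comm' (by simp)
  have hneg : ∏ i, ∏ j ∈ Ioi i, (v i - v j) =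
      (∏ i : Fin N, ∏ _j ∈ Ioi i, (-1)) * ∏ i, ∏ j ∈ Ioi i, (v j - v i) := by
    simp only [← Finset.prod_mul_distrib]
    exact Finset.prod_congr rfl fun i _ => Finset.prod_congr rfl fun j _ => by ring
  simp only [nodeProd, hsplit, Finset.prod_union (hdisj _)]
  rw [Finset.prod_mul_distrib, hcomm, hneg, Matrix.det_vandermonde, sq, mul_assoc]

/-- Automorphisms act on the roots of `f - t g` by even permutations. -/
theorem sign_eq_one_of_map_roots [CharZero K] {a c : Fin N → ℤ} {x : Fin N → K} {t : K}
    (hker : IsCauchyKernel (fun i => (a i : K)) (fun i => (c i : K)) univ)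
    (ha : Function.Injective a) (hc : ∀ i, c i ≠ 0) (ht : t ≠ 0) (hx : Function.Injective x)
    (hroot : ∀ i, IsMestreRoot a c t (x i)) (σ : K →+* K) (hσ : σ t = t) (π : Equiv.Perm (Fin N))
    (hπ : ∀ i, σ (x i) = x (π i)) : Equiv.Perm.sign π = 1 := by
  set w : K := (∏ i, (t * c i * ∑ l, c l / (x i - a l))) *
    (Matrix.vandermonde fun i => (a i : K)).det
  have hdet : (Matrix.vandermonde x).det ^ 2 = w ^ 2 := by
    have hs : (∏ i : Fin N, ∏ _j ∈ Ioi i, (-1 : K)) ≠ 0 :=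
      Finset.prod_ne_zero_iff.2 fun i _ => Finset.prod_ne_zero_iff.2 fun j _ => by simp
    refine mul_left_cancel₀ hs ?_
    rw [← prod_nodeProd_erase_eq_det_sq, prod_nodeProd_erase_roots hker
      (Int.cast_injective.comp ha) (fun i => Int.cast_ne_zero.2 (hc i)) ht hx hroot,
      prod_nodeProd_erase_eq_det_sq]
    ring
  have hw : σ w = w := by
    have h1 : σ (Matrix.vandermonde fun i => (a i : K)).det =
        (Matrix.vandermonde fun i => (a i : K)).det := by
      simp [Matrix.det_vandermonde, map_prod]
    have h2 : σ (∏ i, (t * c i * ∑ l, c l / (x i - a l))) =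
        ∏ i, (t * c i * ∑ l, c l / (x i - a l)) := by
      simp only [Finset.prod_mul_distrib, map_mul, map_prod, map_sum, map_div₀, map_sub,
        map_intCast, hσ, hπ]
      congr 1
      exact Equiv.prod_comp π fun i => ∑ l, (c l : K) / (x i - a l)
    rw [map_mul, h1, h2]
  have hd : σ (Matrix.vandermonde x).det = Equiv.Perm.sign π * (Matrix.vandermonde x).det := by
    rw [← Matrix.det_permute, RingHom.map_det]
    congr 1
    ext i j
    simp [Matrix.vandermonde_apply, hπ]
  have hd' : σ (Matrix.vandermonde x).det = (Matrix.vandermonde x).det := by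
    rcases sq_eq_sq_iff_eq_or_eq_neg.1 hdet with h | h
    · rw [h, hw]
    · rw [h, map_neg, hw]
  have hd0 : (Matrix.vandermonde x).det ≠ 0 := Matrix.det_vandermonde_ne_zero_iff.2 hx
  rw [hd'] at hd
  have : ((Equiv.Perm.sign π : ℤ) : K) = 1 :=
    (mul_right_cancel₀ hd0 (by rw [one_mul]; exact hd)).symm
  exact Units.ext (Int.cast_injective (this.trans Int.cast_one.symm))

end Vandermonde

section PermGroup

open Equiv.Perm

variable {α : Type*} [Fintype α] [DecidableEq α]

theorem Equiv.Perm.eq_one_of_sign_eq_one_of_card_support_le_two {π : Equiv.Perm α}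
    (hs : sign π = 1) (h : π.support.card ≤ 2) : π = 1 := by
  by_contra hne
  have h2 : π.support.card = 2 := le_antisymm h (two_le_card_support_of_ne_one hne)
  have := (card_support_eq_two.1 h2).sign_eq
  rw [hs] at this
  exact absurd this (by decide)

theorem Equiv.Perm.eq_of_sign_eq_one_of_apply_eq {π σ : Equiv.Perm α} {s : Finset α}
    (hs : s.card ≤ 3) (hπ : sign π = 1) (hσ : sign σ = 1) (hπs : π.support ⊆ s)
    (hσs : σ.support ⊆ s) {a : α} (ha : a ∈ s) (hσa : π a = σ a) : π = σ := by
  suffices h : π⁻¹ * σ = 1 from (inv_mul_eq_one.1 h)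
  refine eq_one_of_sign_eq_one_of_card_support_le_two (by simp [hπ, hσ]) ?_
  have hsub : (π⁻¹ * σ).support ⊆ s.erase a := by
    intro i hi
    refine mem_erase.2 ⟨?_, ?_⟩
    · rintro rfl
      rw [mem_support, mul_apply, ← hσa] at hi
      exact hi (π.symm_apply_apply i)
    · have := support_mul_le π⁻¹ σ hi
      rw [support_inv] at this
      rcases mem_union.1 this with h | h
      exacts [hπs h, hσs h]
  have := (Finset.card_le_card hsub).trans (Finset.card_erase_of_mem ha).le
  omega

/-- A nontrivial even permutation supported in the support of a cycle of length three generates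
that cycle. -/
theorem Equiv.Perm.IsThreeCycle.mem_zpowers {σ π : Equiv.Perm α} (hσ : σ.IsThreeCycle)
    (hπ1 : π ≠ 1) (hπ : Equiv.Perm.sign π = 1) (hsupp : ∀ i, i ∉ σ.support → π i = i) :
    σ ∈ Subgroup.zpowers π := by
  have hsub : π.support ⊆ σ.support := fun i hi => by
    by_contra h
    exact mem_support.1 hi (hsupp i h)
  have hcard := hσ.card_support
  have hπ3 : π.IsThreeCycle := by
    refine card_support_eq_three_iff.1 (le_antisymm (hcard ▸ Finset.card_le_card hsub) ?_)
    by_contra! h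
    exact hπ1 (eq_one_of_sign_eq_one_of_card_support_le_two hπ (by omega))
  have heq : π.support = σ.support :=
    Finset.eq_of_subset_of_card_le hsub (by rw [hcard, hπ3.card_support])
  obtain ⟨a, ha⟩ := hπ3.isCycle.nonempty_support
  have hinv : π⁻¹ * π⁻¹ = π := by
    have := pow_orderOf_eq_one π
    rw [hπ3.orderOf] at this
    have h' : π * (π * π) = 1 := by rw [← this, pow_succ', pow_two]
    rw [← mul_inv_rev, ← eq_inv_of_mul_eq_one_left h']
  have hmem : σ a ∈ π.support := by
    rw [heq, apply_mem_support, ← heq]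
    exact ha
  have hthree : π.support = {a, π a, π⁻¹ a} := by
    refine (Finset.eq_of_subset_of_card_le ?_ ?_).symm
    · intro i hi
      simp only [mem_insert, mem_singleton] at hi
      rcases hi with rfl | rfl | rfl
      · exact ha
      · exact apply_mem_support.2 ha
      · rw [← support_inv]
        exact apply_mem_support.2 (by rwa [support_inv])
    · have h1 : π a ≠ a := mem_support.1 ha
      have h2 : π⁻¹ a ≠ a := fun h => h1 (inv_eq_iff_eq.1 h).symm
      have h3 : π a ≠ π⁻¹ a := fun h => by
        have : (π⁻¹ * π⁻¹) a = π⁻¹ a := by rw [hinv, h]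
        rw [mul_apply] at this
        exact h2 (π⁻¹.injective this)
      rw [hπ3.card_support, Finset.card_eq_three.2 ⟨a, π a, π⁻¹ a, h1.symm, h2.symm, h3, rfl⟩]
  rw [hthree] at hmem
  simp only [mem_insert, mem_singleton] at hmem
  have haσ : a ∈ σ.support := heq ▸ ha
  rcases hmem with h | h | h
  · exact absurd h (mem_support.1 haσ)
  · rw [eq_of_sign_eq_one_of_apply_eq hcard.le hσ.sign hπ le_rfl hsub haσ h]
    exact Subgroup.mem_zpowers _
  · rw [eq_of_sign_eq_one_of_apply_eq hcard.le hσ.sign (by simpa using hπ) le_rfl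
      (by rwa [support_inv]) haσ h]
    exact inv_mem (Subgroup.mem_zpowers _)

theorem nonempty_mulEquiv_alternatingGroup {p : α → Prop} [DecidablePred p]
    (R : Subgroup (Equiv.Perm α)) (hsign : ∀ π ∈ R, sign π = 1)
    (hfix : ∀ π ∈ R, ∀ i, ¬ p i → π i = i)
    (hR : ∀ σ : Equiv.Perm α, σ.IsThreeCycle → (∀ i ∈ σ.support, p i) →
      ∃ π ∈ R, π ≠ 1 ∧ ∀ i, i ∉ σ.support → π i = i) :
    Nonempty (R ≃* alternatingGroup (Subtype p)) := by
  have hRmap : (alternatingGroup (Subtype p)).map ofSubtype = R := by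
    refine le_antisymm ?_ fun π hπ => ?_
    · rw [← closure_three_cycles_eq_alternating, MonoidHom.map_closure, Subgroup.closure_le]
      rintro _ ⟨σ, hσ, rfl⟩
      have hσ' : (ofSubtype σ).IsThreeCycle := by
        rw [IsThreeCycle, cycleType_ofSubtype]
        exact hσ
      obtain ⟨π, hπR, hπ1, hπ⟩ := hR _ hσ' fun i hi => by
        by_contra h
        exact mem_support.1 hi (ofSubtype_apply_of_not_mem σ h)
      exact Subgroup.zpowers_le.2 hπR (hσ'.mem_zpowers hπ1 (hsign π hπR) hπ)
    · have h2 : ∀ i, π i ≠ i → p i := fun i hi => by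
        by_contra h
        exact hi (hfix π hπ i h)
      have h1 : ∀ i, p (π i) ↔ p i := fun i => by
        by_cases hi : π i = i
        · rw [hi]
        · exact iff_of_true (h2 _ fun h => hi (π.injective h)) (h2 i hi)
      have hof := ofSubtype_subtypePerm h1 h2
      refine ⟨subtypePerm π h1, ?_, hof⟩
      rw [SetLike.mem_coe, mem_alternatingGroup, ← sign_ofSubtype, hof, hsign π hπ]
  exact ⟨((Subgroup.equivMapOfInjective _ _ ofSubtype_injective).trans
    (MulEquiv.subgroupCongr hRmap)).symm⟩

end PermGroup

section RootPermutation

variable {ι K Ω : Type*} [Fintype ι] [DecidableEq ι] [Field K] [Field Ω] [Algebra K Ω]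

theorem isSplittingField_adjoin_range {x : ι → Ω} {f : K[X]}
    (hf : f.map (algebraMap K Ω) = nodePoly univ x) :
    f.IsSplittingField K (IntermediateField.adjoin K (Set.range x)) := by
  have hsplit : (f.map (algebraMap K Ω)).Splits := by
    rw [hf]
    exact Splits.prod fun i _ => Splits.X_sub_C _
  have hroots : f.rootSet Ω = Set.range x := by
    ext y
    have hf0 : f ≠ 0 := by
      rintro rfl
      rw [Polynomial.map_zero] at hf
      exact (monic_nodePoly univ x).ne_zero hf.symm
    rw [mem_rootSet_of_ne hf0, aeval_def, eval₂_eq_eval_map, hf, eval_nodePoly, nodeProd,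
      Finset.prod_eq_zero_iff]
    simp only [mem_univ, true_and, sub_eq_zero, Set.mem_range, eq_comm]
  rw [← hroots]
  exact IntermediateField.adjoin_rootSet_isSplittingField hsplit

theorem isGalois_adjoin_range {x : ι → Ω} {f : K[X]} (hx : Function.Injective x)
    (hf : f.map (algebraMap K Ω) = nodePoly univ x) :
    IsGalois K (IntermediateField.adjoin K (Set.range x)) := by
  have := isSplittingField_adjoin_range hf
  refine IsGalois.of_separable_splitting_field (p := f) ?_
  rw [← separable_map (algebraMap K Ω), hf]
  exact separable_prod_X_sub_C_iff.2 hx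

theorem finiteDimensional_adjoin_range {x : ι → Ω} {f : K[X]}
    (hf : f.map (algebraMap K Ω) = nodePoly univ x) :
    FiniteDimensional K (IntermediateField.adjoin K (Set.range x)) := by
  have := isSplittingField_adjoin_range hf
  exact IsSplittingField.finiteDimensional _ f

theorem exists_permHom {x : ι → Ω} {f : K[X]} (hx : Function.Injective x)
    (hf : f.map (algebraMap K Ω) = nodePoly univ x) :
    ∃ ρ : Gal(IntermediateField.adjoin K (Set.range x)/K) →* Equiv.Perm ι, Function.Injective ρ ∧
      ∀ g i, ((g ⟨x i, IntermediateField.subset_adjoin K _ (Set.mem_range_self i)⟩ :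
        IntermediateField.adjoin K (Set.range x)) : Ω) = x (ρ g i) := by
  set L := IntermediateField.adjoin K (Set.range x)
  set y : ι → L := fun i => ⟨x i, IntermediateField.subset_adjoin K _ (Set.mem_range_self i)⟩
  have hy : Function.Injective y := fun i j h => hx (congrArg Subtype.val h)
  have hr : ∀ (g : Gal(L/K)) i, ∃ j, g (y i) = y j := by
    intro g i
    have h0 : ∀ z : Ω, aeval z f = nodeProd univ x z := fun z => by
      rw [aeval_def, eval₂_eq_eval_map, hf, eval_nodePoly]
    have h1 : aeval (y i) f = 0 := by
      refine Subtype.val_injective ?_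
      have := aeval_algebraMap_apply Ω (y i) f
      exact this.symm.trans ((h0 _).trans (nodeProd_apply_node _ _ (mem_univ i)))
    have h2 : aeval ((g (y i) : L) : Ω) f = 0 := by
      have h3 : aeval (g (y i)) f = 0 := by
        have := aeval_algHom_apply (g : L →ₐ[K] L) (y i) f
        rw [h1, map_zero] at this
        exact this
      have := aeval_algebraMap_apply Ω (g (y i)) f
      rw [h3, map_zero] at this
      exact this
    rw [h0, nodeProd, Finset.prod_eq_zero_iff] at h2
    obtain ⟨j, -, hj⟩ := h2
    exact ⟨j, Subtype.ext (sub_eq_zero.1 hj)⟩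
  choose r hr using hr
  let ρ : Gal(L/K) →* Function.End ι :=
    { toFun := r
      map_one' := funext fun i => hy ((hr 1 i).symm.trans rfl)
      map_mul' := fun g h => funext fun i => hy (by
        change y (r (g * h) i) = y (r g (r h i))
        rw [← hr, ← hr, ← hr]
        rfl) }
  refine ⟨ρ.toHomPerm, fun g h hgh => ?_, fun g i => congrArg Subtype.val (hr g i)⟩
  have hgh' : (g : L →ₐ[K] L) = h := by
    have hadj : ∀ z (hz : z ∈ L), g ⟨z, hz⟩ = h ⟨z, hz⟩ := by
      intro z hz
      induction hz using IntermediateField.adjoin_induction with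
      | mem z hz =>
        obtain ⟨i, rfl⟩ := hz
        have := congrArg (fun π : Equiv.Perm ι => y (π i)) hgh
        exact (hr g i).trans (this.trans (hr h i).symm)
      | algebraMap z => exact (g.commutes z).trans (h.commutes z).symm
      | add u v hu hv h1 h2 =>
        have := congrArg₂ (· + ·) h1 h2
        simp only [← map_add] at this
        exact this
      | inv u hu h1 =>
        have := congrArg (·⁻¹) h1
        simp only [← map_inv₀] at this
        exact this
      | mul u v hu hv h1 h2 =>
        have := congrArg₂ (· * ·) h1 h2
        simp only [← map_mul] at this
        exact this
    exact AlgHom.ext fun z => hadj z.1 z.2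
  exact AlgEquiv.ext fun z => DFunLike.congr_fun hgh' z

end RootPermutation

theorem IsCauchyKernel.map {ι K K' : Type*} [DecidableEq ι] [Field K] [Field K'] {a v : ι → K}
    {s : Finset ι} (h : IsCauchyKernel a v s) (φ : K →+* K') :
    IsCauchyKernel (fun i => φ (a i)) (fun i => φ (v i)) s := fun i hi => by
  have := congrArg φ (h i hi)
  simpa only [map_sum, map_div₀, map_sub, map_zero] using this

section Galois

variable {k Ω : Type*} [Field k] [Field Ω] [Algebra k Ω] {N : ℕ} {a c : Fin N → ℤ}
  {x : Fin N → Ω} {t : Ω}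

theorem exists_map_eq_nodePoly (hx : Function.Injective x) (hroot : ∀ i, IsMestreRoot a c t (x i))
    (K : IntermediateField k Ω) (ht : t ∈ K) :
    ∃ f : K[X], f.map (algebraMap K Ω) = nodePoly univ x := by
  refine ⟨nodePoly univ (fun i => (a i : K)) - C ⟨t, ht⟩ *
    weightPoly univ (fun i => (a i : K)) (fun i => (c i : K)), ?_⟩
  rw [nodePoly_eq_of_roots hx hroot, Polynomial.map_sub, Polynomial.map_mul, map_C, map_nodePoly,
    map_weightPoly]
  simp only [map_intCast]
  rfl

/-- The Galois group of `f - t g` over the field generated by `t` and some of the roots is the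
alternating group of the remaining roots. -/
theorem nonempty_gal_mulEquiv_alternatingGroup [CharZero Ω]
    (hker : IsCauchyKernel (fun i => (a i : ℚ)) (fun i => (c i : ℚ)) univ)
    (ha : Function.Injective a) (hc : ∀ i, c i ≠ 0) (ht : t ≠ 0) (hx : Function.Injective x)
    (hroot : ∀ i, IsMestreRoot a c t (x i))
    (hsep : ∀ τ : Finset (Fin N), τ.card = 3 → ∀ i ∈ τ,
      x i ∉ IntermediateField.adjoin k (insert t (x '' (τ : Set (Fin N))ᶜ)))
    (J : Finset (Fin N)) (K : IntermediateField k Ω)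
    (hK : K = IntermediateField.adjoin k (insert t (x '' J))) :
    Nonempty (Gal(IntermediateField.adjoin K (Set.range x)/K) ≃*
      alternatingGroup {i // i ∉ J}) := by
  have htK : t ∈ K := by
    rw [hK]
    exact IntermediateField.subset_adjoin _ _ (Set.mem_insert _ _)
  obtain ⟨f, hf⟩ := exists_map_eq_nodePoly hx hroot K htK
  set L := IntermediateField.adjoin K (Set.range x)
  obtain ⟨ρ, hρ, hρx⟩ : ∃ ρ : Gal(L/K) →* Equiv.Perm (Fin N), Function.Injective ρ ∧
      ∀ g i, ((g ⟨x i, IntermediateField.subset_adjoin K _ (Set.mem_range_self i)⟩ : L) : Ω) =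
        x (ρ g i) := exists_permHom hx hf
  have hgal : IsGalois K L := isGalois_adjoin_range hx hf
  have hfin : FiniteDimensional K L := finiteDimensional_adjoin_range hf
  set y : Fin N → L := fun i => ⟨x i, IntermediateField.subset_adjoin K _ (Set.mem_range_self i)⟩
  have hy : Function.Injective y := fun i j h => hx (congrArg Subtype.val h)
  have hyρ : ∀ g i, g (y i) = y (ρ g i) := fun g i => Subtype.ext (hρx g i)
  refine ⟨(MonoidHom.ofInjective hρ).trans (nonempty_mulEquiv_alternatingGroup ρ.range
    ?_ ?_ ?_).some⟩
  · rintro _ ⟨g, rfl⟩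
    have hroot' : ∀ i, IsMestreRoot a c (algebraMap K L ⟨t, htK⟩) (y i) := by
      intro i
      refine (algebraMap L Ω).injective ?_
      rw [map_mul, map_nodeProd, map_weightSum]
      simp only [map_intCast]
      exact hroot i
    refine sign_eq_one_of_map_roots (K := L) ?_ ha hc ?_ hy hroot' (g : L →+* L) (g.commutes _) _
      (hyρ g)
    · simpa using hker.map (algebraMap ℚ L)
    · intro h
      exact ht (congrArg Subtype.val h)
  · rintro _ ⟨g, rfl⟩ i hi
    have hxK : x i ∈ K := by
      rw [hK]
      exact IntermediateField.subset_adjoin _ _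
        (Set.mem_insert_of_mem _ ⟨i, by simpa using hi, rfl⟩)
    refine hy ?_
    rw [← hyρ]
    exact g.commutes ⟨x i, hxK⟩
  · intro σ hσ hJ
    set E : IntermediateField K L := IntermediateField.adjoin K (y '' (σ.support : Set (Fin N))ᶜ)
    have hEx : ∀ i ∈ σ.support, y i ∉ E := by
      intro i hi hmem
      refine hsep σ.support hσ.card_support i hi ?_
      have h1 : x i ∈ E.map L.val := ⟨y i, hmem, rfl⟩
      rw [IntermediateField.adjoin_map, Set.image_image] at h1
      have h2 : x i ∈ (IntermediateField.adjoin K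
        (x '' (σ.support : Set (Fin N))ᶜ)).restrictScalars k := h1
      subst hK
      rw [IntermediateField.adjoin_adjoin_left] at h2
      refine IntermediateField.adjoin.mono _ _ _ ?_ h2
      rintro z ((rfl | ⟨j, hj, rfl⟩) | ⟨j, hj, rfl⟩)
      · exact Set.mem_insert _ _
      · exact Set.mem_insert_of_mem _ ⟨j, fun h => hJ j h hj, rfl⟩
      · exact Set.mem_insert_of_mem _ ⟨j, hj, rfl⟩
    obtain ⟨i, hi⟩ := hσ.isCycle.nonempty_support
    have hfix := hEx i hi
    rw [← IsGalois.fixedField_fixingSubgroup E, IntermediateField.mem_fixedField_iff] at hfix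
    push Not at hfix
    obtain ⟨g, hg, hgi⟩ := hfix
    refine ⟨ρ g, ⟨g, rfl⟩, fun h => hgi ?_, fun j hj => hy ?_⟩
    · rw [hyρ, h, Equiv.Perm.one_apply]
    · rw [← hyρ]
      exact (IntermediateField.mem_fixingSubgroup_iff _ _).1 hg _
        (IntermediateField.subset_adjoin _ _ ⟨j, hj, rfl⟩)

end Galois

theorem LaurentSeries.transcendental_single_one (κ : Type*) [Field κ] :
    Transcendental κ (HahnSeries.single 1 1 : LaurentSeries κ) := by
  rw [transcendental_iff_injective]
  have h : ∀ p : κ[X], aeval (HahnSeries.single 1 1 : LaurentSeries κ) p =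
      HahnSeries.ofPowerSeries ℤ κ p := by
    intro p
    have : ((aeval (HahnSeries.single 1 1 : LaurentSeries κ) : κ[X] →ₐ[κ] LaurentSeries κ) :
        κ[X] →+* LaurentSeries κ) =
        (HahnSeries.ofPowerSeries ℤ κ).comp coeToPowerSeries.ringHom := by
      refine Polynomial.ringHom_ext (fun a => ?_) ?_
      · rw [RingHom.coe_coe, aeval_C, RingHom.comp_apply, coeToPowerSeries.ringHom_apply, coe_C]
        rfl
      · rw [RingHom.coe_coe, aeval_X, RingHom.comp_apply, coeToPowerSeries.ringHom_apply, coe_X,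
          HahnSeries.ofPowerSeries_X]
    exact DFunLike.congr_fun this p
  intro p q hpq
  rw [h, h] at hpq
  exact coe_injective κ (HahnSeries.ofPowerSeries_injective hpq)

theorem IsMestreRoot.mem_adjoin_simple {k Ω : Type*} [Field k] [Field Ω] [CharZero Ω] [Algebra k Ω]
    {N : ℕ} {a c : Fin N → ℤ} {x t : Ω} (ha : Function.Injective a) (hc : ∀ i, c i ≠ 0)
    (ht : t ≠ 0) (h : IsMestreRoot a c t x) : t ∈ IntermediateField.adjoin k {x} := by
  have hf : nodeProd univ (fun j => (a j : Ω)) x ≠ 0 := Finset.prod_ne_zero_iff.2 fun i _ =>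
    root_sub_node_ne_zero (Int.cast_injective.comp ha) (fun i => Int.cast_ne_zero.2 (hc i)) ht h i
  have hg : weightSum univ (fun j => (a j : Ω)) (fun j => (c j : Ω)) x ≠ 0 := fun h0 =>
    hf (by rw [show nodeProd _ _ _ = _ from h, h0, mul_zero])
  rw [eq_div_of_mul_eq hg (show _ = nodeProd univ (fun j => (a j : Ω)) x from h.symm)]
  have hx : x ∈ IntermediateField.adjoin k {x} := IntermediateField.mem_adjoin_simple_self k x
  have hnode : ∀ s : Finset (Fin N), nodeProd s (fun j => (a j : Ω)) x ∈
      IntermediateField.adjoin k {x} := fun s =>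
    prod_mem fun i _ => sub_mem hx (intCast_mem _ _)
  exact div_mem (hnode _) (sum_mem fun i _ => mul_mem (pow_mem (intCast_mem _ _) 2) (hnode _))

/-- Alternating groups are Galois groups of extensions of rational function fields in one variable
which embed into Laurent series. -/
theorem exists_isGalois_alternatingGroup (κ : Type*) [Field κ] [CharZero κ] {m : ℕ} (hm : 4 ≤ m) :
    ∃ z : LaurentSeries κ, Transcendental κ z ∧
      ∃ L : IntermediateField (IntermediateField.adjoin κ {z}) (LaurentSeries κ),
        FiniteDimensional (IntermediateField.adjoin κ {z}) L ∧
        IsGalois (IntermediateField.adjoin κ {z}) L ∧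
        Nonempty (Gal(L/IntermediateField.adjoin κ {z}) ≃* alternatingGroup (Fin m)) := by
  have hΩ : CharZero (LaurentSeries κ) :=
    charZero_of_injective_algebraMap (algebraMap κ (LaurentSeries κ)).injective
  have ht : (HahnSeries.single 1 1 : LaurentSeries κ) ≠ 0 := by simp
  have hT := LaurentSeries.transcendental_single_one κ
  rcases Nat.even_or_odd m with hev | hodd
  · obtain ⟨a, c, ha, hc, hker, x, hx, hroot, hsep⟩ :=
      exists_laurentSeries_mestreRoots κ (N := m + 1) hev.add_one (by omega)
    have hmem := (hroot 0).mem_adjoin_simple (k := κ) ha hc ht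
    have hK : IntermediateField.adjoin κ {x 0} = IntermediateField.adjoin κ
        (insert (HahnSeries.single 1 1)
          (x '' (({0} : Finset (Fin (m + 1))) : Set (Fin (m + 1))))) := by
      rw [Finset.coe_singleton, Set.image_singleton]
      refine le_antisymm (IntermediateField.adjoin.mono _ _ _ (by simp)) ?_
      rw [IntermediateField.adjoin_le_iff]
      rintro y (rfl | rfl)
      exacts [hmem, IntermediateField.mem_adjoin_simple_self κ _]
    obtain ⟨f, hf⟩ := exists_map_eq_nodePoly hx hroot _ hmem
    refine ⟨x 0, fun halg => hT ?_, IntermediateField.adjoin _ (Set.range x),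
      finiteDimensional_adjoin_range hf, isGalois_adjoin_range hx hf, ?_⟩
    · have := (IntermediateField.isAlgebraic_adjoin_simple halg.isIntegral).isAlgebraic
        (⟨_, hmem⟩ : IntermediateField.adjoin κ {x 0})
      exact this.algebraMap
    · obtain ⟨e⟩ := nonempty_gal_mulEquiv_alternatingGroup hker ha hc ht hx hroot hsep {0} _ hK
      exact ⟨e.trans (Equiv.altCongrHom (Fintype.equivFinOfCardEq (by simp)))⟩
  · obtain ⟨a, c, ha, hc, hker, x, hx, hroot, hsep⟩ :=
      exists_laurentSeries_mestreRoots κ hodd (by omega)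
    have hK : IntermediateField.adjoin κ {(HahnSeries.single 1 1 : LaurentSeries κ)} =
        IntermediateField.adjoin κ
          (insert (HahnSeries.single 1 1) (x '' ((∅ : Finset (Fin m)) : Set (Fin m)))) := by
      simp
    obtain ⟨f, hf⟩ := exists_map_eq_nodePoly hx hroot _
      (IntermediateField.mem_adjoin_simple_self κ (HahnSeries.single 1 1 : LaurentSeries κ))
    refine ⟨_, hT, IntermediateField.adjoin _ (Set.range x), finiteDimensional_adjoin_range hf,
      isGalois_adjoin_range hx hf, ?_⟩
    obtain ⟨e⟩ := nonempty_gal_mulEquiv_alternatingGroup hker ha hc ht hx hroot hsep ∅ _ hK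
    exact ⟨e.trans (Equiv.altCongrHom (Fintype.equivFinOfCardEq (by simp)))⟩

/-- The ring homomorphism of Hahn series induced by a ring homomorphism of coefficients. -/
noncomputable def HahnSeries.mapRingHom (Γ : Type*) [AddCommMonoid Γ] [PartialOrder Γ]
    [IsOrderedCancelAddMonoid Γ] {R S : Type*} [Ring R] [Ring S] (f : R →+* S) :
    HahnSeries Γ R →+* HahnSeries Γ S where
  toFun x := x.map f
  map_one' := HahnSeries.map_one f.toMonoidWithZeroHom
  map_mul' x y := HahnSeries.map_mul (f : R →ₙ+* S) (x := x) (y := y)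
  map_zero' := by ext; simp
  map_add' x y := HahnSeries.map_add (f : R →+ S) (x := x) (y := y)

section HahnTensor

variable {k κ H Ω : Type*} [Field k] [Field κ] [Algebra k κ] [Ring H] [Algebra k H]
  [Field Ω] [Algebra k Ω]

/-- The canonical map from `Ω ⊗ H` to Hahn series over `κ ⊗ H`, for a field `Ω` of Hahn series
over `κ`. -/
noncomputable def tensorToHahnSeries (e : Ω →+* HahnSeries ℤ κ)
    (he : ∀ c : k, e (algebraMap k Ω c) = HahnSeries.C (algebraMap k κ c)) :
    Ω ⊗[k] H →ₐ[k] HahnSeries ℤ (κ ⊗[k] H) :=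
  Algebra.TensorProduct.lift
    { toRingHom := (HahnSeries.mapRingHom ℤ
        (Algebra.TensorProduct.includeLeft : κ →ₐ[k] κ ⊗[k] H).toRingHom).comp e
      commutes' := fun c => by
        ext n
        by_cases h : n = 0 <;>
        simp [he, HahnSeries.mapRingHom, HahnSeries.algebraMap_apply, HahnSeries.C_apply, h,
          Algebra.TensorProduct.algebraMap_apply] }
    { toRingHom := HahnSeries.C.comp
        (Algebra.TensorProduct.includeRight : H →ₐ[k] κ ⊗[k] H).toRingHom
      commutes' := fun c => by
        simp [HahnSeries.algebraMap_apply, Algebra.TensorProduct.algebraMap_apply] }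
    fun x y => by
      ext n
      simp [HahnSeries.mapRingHom, HahnSeries.C_apply]

theorem coeff_tensorToHahnSeries_tmul (e : Ω →+* HahnSeries ℤ κ)
    (he : ∀ c : k, e (algebraMap k Ω c) = HahnSeries.C (algebraMap k κ c)) (x : Ω) (y : H) (n : ℤ) :
    (tensorToHahnSeries e he (x ⊗ₜ[k] y)).coeff n = (e x).coeff n ⊗ₜ[k] y := by
  simp [tensorToHahnSeries, HahnSeries.mapRingHom, HahnSeries.C_apply]

theorem injective_tensorToHahnSeries (e : Ω →+* HahnSeries ℤ κ)
    (he : ∀ c : k, e (algebraMap k Ω c) = HahnSeries.C (algebraMap k κ c)) :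
    Function.Injective (tensorToHahnSeries (H := H) e he) := by
  let b := Module.Basis.ofVectorSpace k H
  have key : ∀ (w : Ω ⊗[k] H) (n : ℤ) (i),
      (Algebra.TensorProduct.basis κ b).repr ((tensorToHahnSeries e he w).coeff n) i =
        (e ((Algebra.TensorProduct.basis Ω b).repr w i)).coeff n := by
    intro w n i
    induction w with
    | zero => simp
    | add w w' h h' => simp [h, h']
    | tmul x y =>
      rw [coeff_tensorToHahnSeries_tmul, Algebra.TensorProduct.basis_repr_tmul,
        Algebra.TensorProduct.basis_repr_tmul]
      simp [he]
  rw [injective_iff_map_eq_zero]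
  intro w hw
  refine (Algebra.TensorProduct.basis Ω b).repr.injective ?_
  ext i
  refine e.injective ?_
  ext n
  rw [← key, hw]
  simp

theorem noZeroDivisors_tensorProduct_of_hahnSeries [NoZeroDivisors (κ ⊗[k] H)]
    (e : Ω →+* HahnSeries ℤ κ)
    (he : ∀ c : k, e (algebraMap k Ω c) = HahnSeries.C (algebraMap k κ c)) :
    NoZeroDivisors (Ω ⊗[k] H) :=
  (injective_tensorToHahnSeries (H := H) e he).noZeroDivisors _ (map_zero _) (map_mul _)

end HahnTensor

/-- The field `κ` is the field of fractions of the domain `R` via `j`. -/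
def IsFieldOfFractions {R κ : Type*} [CommRing R] [Field κ] (j : R →+* κ) : Prop :=
  Function.Injective j ∧ ∀ x : κ, ∃ a b : R, b ≠ 0 ∧ x * j b = j a

namespace IsFieldOfFractions

theorem comp_ringEquiv {R S κ : Type*} [CommRing R] [CommRing S] [Field κ] {j : R →+* κ}
    (hj : IsFieldOfFractions j) (f : S ≃+* R) :
    IsFieldOfFractions (j.comp f.toRingHom) := by
  refine ⟨hj.1.comp f.injective, fun x => ?_⟩
  obtain ⟨a, b, hb, h⟩ := hj.2 x
  exact ⟨f.symm a, f.symm b, by simpa using hb, by simpa using h⟩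

variable {R κ : Type*} [CommRing R] [IsDomain R] [Field κ] {j : R →+* κ}

theorem exists_mul_eq_map (hj : IsFieldOfFractions j) (r : κ[X]) :
    ∃ (b : R) (p : R[X]), b ≠ 0 ∧ r * C (j b) = p.map j := by
  induction r using Polynomial.induction_on' with
  | add r s hr hs =>
    obtain ⟨b, p, hb, hp⟩ := hr
    obtain ⟨c, q, hc, hq⟩ := hs
    refine ⟨b * c, p * C c + q * C b, mul_ne_zero hb hc, ?_⟩
    rw [Polynomial.map_add, Polynomial.map_mul, Polynomial.map_mul, ← hp, ← hq, map_mul,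
      C_mul, map_C, map_C]
    ring
  | monomial n x =>
    obtain ⟨a, b, hb, h⟩ := hj.2 x
    exact ⟨b, monomial n a, hb, by rw [monomial_mul_C, h, map_monomial]⟩

theorem adjoin_transcendental (hj : IsFieldOfFractions j) {Ω : Type*} [Field Ω] [Algebra κ Ω]
    {z : Ω} (hz : Transcendental κ z) :
    IsFieldOfFractions ((aeval (IntermediateField.AdjoinSimple.gen κ z)).toRingHom.comp
      (mapRingHom j)) := by
  have hval : ∀ p : κ[X], ((aeval (IntermediateField.AdjoinSimple.gen κ z) p :
      IntermediateField.adjoin κ {z}) : Ω) = aeval z p := fun p => by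
    rw [← IntermediateField.coe_val, ← Polynomial.aeval_algHom_apply]
    simp
  have hne : ∀ p : κ[X], p ≠ 0 → aeval z p ≠ 0 := fun p hp h => hz ⟨p, hp, h⟩
  have hinj : Function.Injective ((aeval (IntermediateField.AdjoinSimple.gen κ z)).toRingHom.comp
      (mapRingHom j)) := by
    rw [injective_iff_map_eq_zero]
    intro p hp
    by_contra hp0
    refine hne (p.map j) ((Polynomial.map_ne_zero_iff hj.1).2 hp0) ?_
    rw [← hval]
    exact congrArg Subtype.val hp
  refine ⟨hinj, fun x => ?_⟩
  obtain ⟨r, s, hrs⟩ := (IntermediateField.mem_adjoin_simple_iff κ _).1 x.2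
  rcases eq_or_ne s 0 with rfl | hs
  · refine ⟨0, 1, one_ne_zero, Subtype.ext ?_⟩
    simp [hrs]
  obtain ⟨b, p, hb, hp⟩ := hj.exists_mul_eq_map r
  obtain ⟨c, q, hc, hq⟩ := hj.exists_mul_eq_map s
  have hjb : C (j b) ≠ 0 := by simpa using (map_ne_zero_iff j hj.1).2 hb
  have hjc : C (j c) ≠ 0 := by simpa using (map_ne_zero_iff j hj.1).2 hc
  refine ⟨p * C c, q * C b, ?_, Subtype.ext ?_⟩
  · have : q.map j ≠ 0 := hq ▸ mul_ne_zero hs hjc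
    exact mul_ne_zero (fun h => this (by simp [h])) (by simpa using hb)
  · change (x : Ω) * ((aeval (IntermediateField.AdjoinSimple.gen κ z) ((q * C b).map j) :
      IntermediateField.adjoin κ {z}) : Ω) = ((aeval (IntermediateField.AdjoinSimple.gen κ z)
        ((p * C c).map j) : IntermediateField.adjoin κ {z}) : Ω)
    rw [hval, hval, hrs, Polynomial.map_mul, Polynomial.map_mul, ← hp, ← hq, map_C, map_C]
    simp only [map_mul]
    have := hne s hs
    field_simp

end IsFieldOfFractions

section Tower

variable {k κ H : Type*} [Field k] [Field κ] [Algebra k κ] [Ring H] [Algebra k H]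

theorem IsFieldOfFractions.exists_mvPolynomial_succ {n : ℕ} {j : MvPolynomial (Fin n) k →ₐ[k] κ}
    (hj : IsFieldOfFractions (j : MvPolynomial (Fin n) k →+* κ)) {Ω : Type*} [Field Ω]
    [Algebra κ Ω] [Algebra k Ω] [IsScalarTower k κ Ω] {z : Ω} (hz : Transcendental κ z) :
    ∃ j' : MvPolynomial (Fin (n + 1)) k →ₐ[k] IntermediateField.adjoin κ {z},
      IsFieldOfFractions (j' : MvPolynomial (Fin (n + 1)) k →+*
        IntermediateField.adjoin κ {z}) := by
  refine ⟨(((aeval (IntermediateField.AdjoinSimple.gen κ z)).restrictScalars k).comp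
    (Polynomial.mapAlgHom j)).comp (MvPolynomial.finSuccEquiv k n).toAlgHom, ?_⟩
  exact (hj.adjoin_transcendental hz).comp_ringEquiv (MvPolynomial.finSuccEquiv k n).toRingEquiv

theorem noZeroDivisors_tensorProduct_of_injective {E Ω : Type*} [Field E] [Field Ω] [Algebra k E]
    [Algebra k Ω] [NoZeroDivisors (Ω ⊗[k] H)] (f : E →ₐ[k] Ω) : NoZeroDivisors (E ⊗[k] H) := by
  have hf : Function.Injective (Algebra.TensorProduct.map f (AlgHom.id k H)) :=
    Module.Flat.rTensor_preserves_injective_linearMap (M := H) f.toLinearMap f.injective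
  exact hf.noZeroDivisors _ (map_zero _) (map_mul _)

end Tower

theorem IsFieldOfFractions.exists_mvPolynomial_succ_of_hahnSeries {k κ H Ω : Type v} [Field k]
    [Field κ] [Algebra k κ] [Ring H] [Algebra k H] [NoZeroDivisors (κ ⊗[k] H)] {n : ℕ}
    {j : MvPolynomial (Fin n) k →ₐ[k] κ}
    (hj : IsFieldOfFractions (j : MvPolynomial (Fin n) k →+* κ)) [Field Ω] [Algebra κ Ω]
    (e : Ω →+* HahnSeries ℤ κ) (he : ∀ c, e (algebraMap κ Ω c) = HahnSeries.C c)
    {z : Ω} (hz : Transcendental κ z) :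
    ∃ (κ' : Type v) (_ : Field κ') (_ : Algebra k κ') (j' : MvPolynomial (Fin (n + 1)) k →ₐ[k] κ'),
      IsFieldOfFractions (j' : MvPolynomial (Fin (n + 1)) k →+* κ') ∧
        NoZeroDivisors (κ' ⊗[k] H) := by
  let _ : Algebra k Ω := ((algebraMap κ Ω).comp (algebraMap k κ)).toAlgebra
  have : IsScalarTower k κ Ω := IsScalarTower.of_algebraMap_eq fun _ => rfl
  obtain ⟨j', hj'⟩ := hj.exists_mvPolynomial_succ hz
  have : NoZeroDivisors (Ω ⊗[k] H) :=
    noZeroDivisors_tensorProduct_of_hahnSeries e fun c => he _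
  exact ⟨_, inferInstance, inferInstance, j', hj', noZeroDivisors_tensorProduct_of_injective
    ((IntermediateField.val _).restrictScalars k)⟩

theorem exists_isFieldOfFractions_mvPolynomial (k H : Type v) [Field k] [Ring H] [Algebra k H]
    [NoZeroDivisors H] (n : ℕ) :
    ∃ (κ : Type v) (_ : Field κ) (_ : Algebra k κ) (j : MvPolynomial (Fin n) k →ₐ[k] κ),
      IsFieldOfFractions (j : MvPolynomial (Fin n) k →+* κ) ∧ NoZeroDivisors (κ ⊗[k] H) := by
  induction n with
  | zero =>
    refine ⟨k, inferInstance, inferInstance, (MvPolynomial.isEmptyAlgEquiv k (Fin 0)).toAlgHom,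
      ⟨(MvPolynomial.isEmptyAlgEquiv k (Fin 0)).injective, fun x => ?_⟩, ?_⟩
    · exact ⟨(MvPolynomial.isEmptyAlgEquiv k (Fin 0)).symm x, 1, one_ne_zero, by
        rw [map_one, mul_one]
        exact ((MvPolynomial.isEmptyAlgEquiv k (Fin 0)).apply_symm_apply x).symm⟩
    · exact (Algebra.TensorProduct.lid k H).injective.noZeroDivisors _ (map_zero _) (map_mul _)
  | succ n ih =>
    obtain ⟨κ, _, _, j, hj, _⟩ := ih
    exact hj.exists_mvPolynomial_succ_of_hahnSeries (RingHom.id (LaurentSeries κ))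
      (fun c => HahnSeries.ofPowerSeries_C _) (LaurentSeries.transcendental_single_one κ)

theorem exists_isGalois_alternatingGroup_over_mvPolynomial (k H : Type v) [Field k] [CharZero k]
    [Ring H] [Algebra k H] [NoZeroDivisors H] (n : ℕ) {m : ℕ} (hm : 4 ≤ m) :
    ∃ (E L : Type v) (_ : Field E) (_ : Field L) (_ : Algebra k E) (_ : Algebra k L)
      (_ : Algebra E L) (_ : IsScalarTower k E L) (j : MvPolynomial (Fin (n + 1)) k →ₐ[k] E),
      IsFieldOfFractions (j : MvPolynomial (Fin (n + 1)) k →+* E) ∧ NoZeroDivisors (L ⊗[k] H) ∧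
        FiniteDimensional E L ∧ IsGalois E L ∧
        Nonempty (Gal(L/E) ≃* alternatingGroup (Fin m)) := by
  obtain ⟨κ, _, _, j, hj, _⟩ := exists_isFieldOfFractions_mvPolynomial k H n
  have : CharZero κ := charZero_of_injective_algebraMap (algebraMap k κ).injective
  obtain ⟨z, hz, L, hfin, hgal, hgrp⟩ := exists_isGalois_alternatingGroup κ hm
  obtain ⟨Ω, _, _, e, he, z, hz, L, hfin, hgal, hgrp⟩ :
      ∃ (Ω : Type v) (_ : Field Ω) (_ : Algebra κ Ω) (e : Ω →+* HahnSeries ℤ κ)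
        (_ : ∀ c, e (algebraMap κ Ω c) = HahnSeries.C c) (z : Ω) (_ : Transcendental κ z)
        (L : IntermediateField (IntermediateField.adjoin κ {z}) Ω),
        FiniteDimensional (IntermediateField.adjoin κ {z}) L ∧
        IsGalois (IntermediateField.adjoin κ {z}) L ∧
        Nonempty (Gal(L/IntermediateField.adjoin κ {z}) ≃* alternatingGroup (Fin m)) :=
    ⟨LaurentSeries κ, inferInstance, inferInstance, RingHom.id (LaurentSeries κ),
      fun c => HahnSeries.ofPowerSeries_C c, z, hz, L, hfin, hgal, hgrp⟩
  let _ : Algebra k Ω := ((algebraMap κ Ω).comp (algebraMap k κ)).toAlgebra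
  have : IsScalarTower k κ Ω := IsScalarTower.of_algebraMap_eq fun _ => rfl
  obtain ⟨j', hj'⟩ := hj.exists_mvPolynomial_succ hz
  have : NoZeroDivisors (Ω ⊗[k] H) :=
    noZeroDivisors_tensorProduct_of_hahnSeries e fun c => he _
  have : IsScalarTower k (IntermediateField.adjoin κ {z}) Ω :=
    IsScalarTower.of_algebraMap_eq fun _ => rfl
  exact ⟨IntermediateField.adjoin κ {z}, L, inferInstance, inferInstance, inferInstance,
    inferInstance, inferInstance, inferInstance, j', hj',
    noZeroDivisors_tensorProduct_of_injective (L.val.restrictScalars k), hfin, hgal, hgrp⟩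

section GaloisTensor

variable {k E L H : Type*} [Field k] [Field E] [Field L] [Algebra k E] [Algebra k L] [Algebra E L]
  [IsScalarTower k E L] [Ring H] [Algebra k H]

variable (k E L H) in
/-- The inclusion of `E ⊗ H` into `L ⊗ H`. -/
noncomputable def tensorInclusion : E ⊗[k] H →+* L ⊗[k] H :=
  (Algebra.TensorProduct.map (IsScalarTower.toAlgHom k E L) (AlgHom.id k H)).toRingHom

@[simp]
theorem tensorInclusion_tmul (x : E) (y : H) :
    tensorInclusion k E L H (x ⊗ₜ y) = algebraMap E L x ⊗ₜ y := rfl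

variable (k E L H) in
/-- The action of the Galois group of `L/E` on `L ⊗ H` through the first factor. -/
noncomputable def galTensorAut : Gal(L/E) →* RingAut (L ⊗[k] H) where
  toFun g := (Algebra.TensorProduct.congr (g.restrictScalars k) AlgEquiv.refl).toRingEquiv
  map_one' := by
    ext w
    induction w with
    | zero => simp
    | add w w' h h' => rw [map_add, map_add, h, h']
    | tmul x y => rfl
  map_mul' g g' := by
    ext w
    induction w with
    | zero => simp
    | add w w' h h' => rw [map_add, map_add, h, h']
    | tmul x y => rfl

@[simp]
theorem galTensorAut_tmul (g : Gal(L/E)) (x : L) (y : H) :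
    galTensorAut k E L H g (x ⊗ₜ y) = g x ⊗ₜ y := rfl

theorem galTensorAut_tensorInclusion (g : Gal(L/E)) (w : E ⊗[k] H) :
    galTensorAut k E L H g (tensorInclusion k E L H w) = tensorInclusion k E L H w := by
  induction w with
  | zero => simp
  | add w w' h h' => rw [map_add, map_add, h, h']
  | tmul x y => simp

theorem tmul_one_injective [Nontrivial H] :
    Function.Injective fun x : L => x ⊗ₜ[k] (1 : H) :=
  Algebra.TensorProduct.includeLeft_injective (S := k) (algebraMap k H).injective

theorem galTensorAut_injective [Nontrivial H] : Function.Injective (galTensorAut k E L H) := by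
  intro g g' h
  ext x
  exact tmul_one_injective (k := k) (H := H) (congrArg (fun σ => σ (x ⊗ₜ[k] (1 : H))) h)

theorem exists_eq_tmul_one_of_forall_commute [Algebra.IsCentral k H] {w : L ⊗[k] H}
    (hw : ∀ y : H, (1 ⊗ₜ y) * w = w * (1 ⊗ₜ y)) : ∃ x : L, w = x ⊗ₜ 1 := by
  have hmem : w ∈ Subalgebra.centralizer k
      (Algebra.TensorProduct.includeRight : H →ₐ[k] L ⊗[k] H).range := by
    rw [Subalgebra.mem_centralizer_iff]
    rintro _ ⟨y, rfl⟩
    exact hw y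
  rw [Subalgebra.centralizer_range_includeRight_eq_center_tensorProduct] at hmem
  obtain ⟨v, rfl⟩ := hmem
  clear hw
  induction v with
  | zero => exact ⟨0, by simp⟩
  | add v v' h h' =>
    obtain ⟨x, hx⟩ := h
    obtain ⟨x', hx'⟩ := h'
    exact ⟨x + x', by rw [map_add, hx, hx', TensorProduct.add_tmul]⟩
  | tmul x y =>
    obtain ⟨c, hc⟩ := Algebra.mem_bot.1 ((Algebra.IsCentral.center_eq_bot k H).le y.2)
    refine ⟨c • x, ?_⟩
    simp [← hc, Algebra.algebraMap_eq_smul_one, TensorProduct.smul_tmul]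

theorem exists_galTensorAut_eq [FiniteDimensional E L] [Nontrivial H] [Algebra.IsCentral k H]
    (τ : RingAut (L ⊗[k] H))
    (hτ : ∀ w, τ (tensorInclusion k E L H w) = tensorInclusion k E L H w) :
    ∃ g, galTensorAut k E L H g = τ := by
  have hr : ∀ y : H, τ (1 ⊗ₜ y) = 1 ⊗ₜ y := fun y => by simpa using hτ (1 ⊗ₜ y)
  have hex : ∀ x : L, ∃ x' : L, τ (x ⊗ₜ 1) = x' ⊗ₜ 1 := fun x => by
    refine exists_eq_tmul_one_of_forall_commute fun y => ?_
    rw [← hr y, ← map_mul, ← map_mul]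
    simp
  choose f hf using hex
  have hinj := tmul_one_injective (k := k) (L := L) (H := H)
  let F : L →ₐ[E] L :=
    { toFun := f
      map_one' := hinj (by
        simpa [← Algebra.TensorProduct.one_def] using (hf 1).symm)
      map_mul' := fun x y => hinj (by
        simpa [hf] using map_mul τ (x ⊗ₜ[k] (1 : H)) (y ⊗ₜ 1) )
      map_zero' := hinj (by simpa using (hf 0).symm)
      map_add' := fun x y => hinj (by
        simpa [hf, ← TensorProduct.add_tmul] using map_add τ (x ⊗ₜ[k] (1 : H)) (y ⊗ₜ 1))
      commutes' := fun c => hinj (by simpa [hf] using hτ (c ⊗ₜ 1)) }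
  refine ⟨AlgEquiv.ofBijective F F.bijective, RingEquiv.ext fun w => ?_⟩
  induction w with
  | zero => simp
  | add w w' h h' => rw [map_add, map_add, h, h']
  | tmul x y =>
    have := map_mul τ (x ⊗ₜ[k] (1 : H)) (1 ⊗ₜ y)
    rw [hf, hr] at this
    have hF : F x = f x := rfl
    simpa [hF] using this.symm

theorem mem_range_tensorInclusion_of_forall_galTensorAut [IsGalois E L] [FiniteDimensional E L]
    [Module.Finite k H] {w : L ⊗[k] H} (hw : ∀ g, galTensorAut k E L H g w = w) :
    w ∈ Set.range (tensorInclusion k E L H) := by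
  let b := Module.finBasis k H
  have hrepr : ∀ (g : Gal(L/E)) (v : L ⊗[k] H) (i), (Algebra.TensorProduct.basis L b).repr
      (galTensorAut k E L H g v) i = g ((Algebra.TensorProduct.basis L b).repr v i) := by
    intro g v i
    induction v with
    | zero => simp
    | add v v' h h' => simp [h, h']
    | tmul x y =>
      rw [galTensorAut_tmul, Algebra.TensorProduct.basis_repr_tmul,
        Algebra.TensorProduct.basis_repr_tmul]
      simp [IsScalarTower.algebraMap_apply k E L]
  have hmem : ∀ i, ∃ c : E, algebraMap E L c = (Algebra.TensorProduct.basis L b).repr w i :=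
    fun i => (IsGalois.mem_range_algebraMap_iff_fixed _).2 fun g => by rw [← hrepr, hw]
  choose c hc using hmem
  refine ⟨∑ i, c i ⊗ₜ b i, ?_⟩
  conv_rhs => rw [← (Algebra.TensorProduct.basis L b).sum_repr w]
  simp [hc, TensorProduct.smul_tmul']

end GaloisTensor

/-- Ring isomorphic rings have isomorphic automorphism groups. -/
def RingAut.autCongr {R S : Type*} [Ring R] [Ring S] (θ : R ≃+* S) : RingAut R ≃* RingAut S where
  toFun σ := (θ.symm.trans σ).trans θ
  invFun σ := (θ.trans σ).trans θ.symm
  left_inv σ := by ext; simp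
  right_inv σ := by ext; simp
  map_mul' σ τ := by ext; simp [RingAut.mul_apply]

section GaloisTransport

variable {k E L H : Type*} [Field k] [Field E] [Field L] [Algebra k E] [Algebra k L] [Algebra E L]
  [IsScalarTower k E L] [Ring H] [Nontrivial H] [Algebra k H] [Algebra.IsCentral k H]
  [FiniteDimensional E L] {F M : Type*} [DivisionRing F] [DivisionRing M]

/-- The inclusion of `F ≃ E ⊗ H` into `M ≃ L ⊗ H`. -/
noncomputable def tensorInclusionTransport (ψ : F ≃+* E ⊗[k] H) (θ : L ⊗[k] H ≃+* M) : F →+* M :=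
  ((θ : L ⊗[k] H →+* M).comp (tensorInclusion k E L H)).comp (ψ : F →+* E ⊗[k] H)

theorem range_galTensorAut_transport (ψ : F ≃+* E ⊗[k] H) (θ : L ⊗[k] H ≃+* M) :
    ((RingAut.autCongr θ).toMonoidHom.comp (galTensorAut k E L H)).range =
      fixingAut (tensorInclusionTransport ψ θ) := by
  ext σ
  constructor
  · rintro ⟨g, rfl⟩ x
    simp [tensorInclusionTransport, RingAut.autCongr, galTensorAut_tensorInclusion]
  · intro hσ
    obtain ⟨g, hg⟩ := exists_galTensorAut_eq (E := E) ((RingAut.autCongr θ).symm σ) fun w => by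
      have := hσ (ψ.symm w)
      apply θ.injective
      simpa [tensorInclusionTransport, RingAut.autCongr] using this
    exact ⟨g, by simp [hg]⟩

theorem nonempty_fixingAut_mulEquiv_gal (ψ : F ≃+* E ⊗[k] H) (θ : L ⊗[k] H ≃+* M) :
    Nonempty (fixingAut (tensorInclusionTransport ψ θ) ≃* Gal(L/E)) := by
  rw [← range_galTensorAut_transport]
  exact ⟨(MonoidHom.ofInjective ((RingAut.autCongr θ).injective.comp galTensorAut_injective)).symm⟩

theorem isGaloisExt_tensorInclusionTransport [IsGalois E L] [Module.Finite k H]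
    (ψ : F ≃+* E ⊗[k] H) (θ : L ⊗[k] H ≃+* M) : IsGaloisExt (tensorInclusionTransport ψ θ) := by
  intro x hx
  obtain ⟨w, hw⟩ := mem_range_tensorInclusion_of_forall_galTensorAut (k := k) (E := E)
    (w := θ.symm x) fun g => by
      apply θ.injective
      have := hx (RingAut.autCongr θ (galTensorAut k E L H g))
        (by rw [← range_galTensorAut_transport]; exact ⟨g, rfl⟩)
      simpa [RingAut.autCongr] using this
  exact ⟨ψ.symm w, by simp [tensorInclusionTransport, hw]⟩

end GaloisTransport

section Small

variable {k L H : Type v} {E : Type*} [Field k] [Field E] [Field L] [Algebra k E] [Algebra k L]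
  [Algebra E L] [IsScalarTower k E L] [Ring H] [Algebra k H]

theorem small_tensorProduct_of_finiteDimensional [FiniteDimensional E L] [Small.{u} (E ⊗[k] H)] :
    Small.{u} (L ⊗[k] H) := by
  let b := Module.finBasis E L
  refine small_of_surjective (α := Fin (Module.finrank E L) → E ⊗[k] H)
    (f := fun f => ∑ i, (b i ⊗ₜ 1) * tensorInclusion k E L H (f i)) fun w => ?_
  induction w with
  | zero => exact ⟨0, by simp⟩
  | add w w' h h' =>
    obtain ⟨f, rfl⟩ := h
    obtain ⟨f', rfl⟩ := h'
    exact ⟨f + f', by simp [mul_add, Finset.sum_add_distrib]⟩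
  | tmul x y =>
    refine ⟨fun i => b.repr x i ⊗ₜ y, ?_⟩
    conv_rhs => rw [← b.sum_repr x]
    simp [TensorProduct.sum_tmul, Algebra.smul_def, mul_comm]

theorem exists_divisionRing_ringEquiv_tensorProduct [Nontrivial H] [Module.Finite k H]
    [NoZeroDivisors (L ⊗[k] H)] [Small.{u} (L ⊗[k] H)] :
    ∃ (M : Type u) (_ : DivisionRing M), Nonempty (L ⊗[k] H ≃+* M) := by
  have : Nontrivial (L ⊗[k] H) := tmul_one_injective.nontrivial
  have : IsDomain (L ⊗[k] H) := NoZeroDivisors.to_isDomain _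
  let D : DivisionRing (L ⊗[k] H) := divisionRingOfFiniteDimensional L (L ⊗[k] H)
  let e : Shrink.{u} (L ⊗[k] H) ≃+* L ⊗[k] H := (equivShrink (L ⊗[k] H)).symm.ringEquiv
  exact ⟨Shrink.{u} (L ⊗[k] H), (equivShrink (L ⊗[k] H)).symm.divisionRing, ⟨e.symm⟩⟩

end Small

section Density

variable (k : Type*) {H : Type*} [Field k] [DivisionRing H] [Algebra k H]

theorem isSimpleModule_range_mulLeftRight : IsSimpleModule (AlgHom.mulLeftRight k H).range H := by
  rw [isSimpleModule_iff_toSpanSingleton_surjective]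
  refine ⟨inferInstance, fun x hx y => ?_⟩
  refine ⟨⟨_, (y * x⁻¹) ⊗ₜ 1, rfl⟩, ?_⟩
  simp [Subalgebra.smul_def, hx]

variable [Algebra.IsCentral k H]

theorem exists_smul_eq_of_endomorphism (g : Module.End (AlgHom.mulLeftRight k H).range H) :
    ∃ c : k, ∀ x, g x = c • x := by
  have hl : ∀ a x : H, g (a * x) = a * g x := fun a x => by
    have := g.map_smul ⟨_, a ⊗ₜ 1, rfl⟩ x
    simpa [Subalgebra.smul_def] using this
  have hr : ∀ a x : H, g (x * a) = g x * a := fun a x => by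
    have := g.map_smul ⟨_, 1 ⊗ₜ MulOpposite.op a, rfl⟩ x
    simpa [Subalgebra.smul_def] using this
  have hmem : g 1 ∈ Subalgebra.center k H := by
    rw [Subalgebra.mem_center_iff]
    intro a
    rw [← hl, ← hr, mul_one, one_mul]
  rw [Algebra.IsCentral.center_eq_bot] at hmem
  obtain ⟨c, hc⟩ := Algebra.mem_bot.1 hmem
  exact ⟨c, fun x => by rw [Algebra.smul_def, hc, ← hr, one_mul]⟩

theorem mulLeftRight_surjective [Module.Finite k H] :
    Function.Surjective (AlgHom.mulLeftRight k H) := by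
  classical
  intro f
  have := isSimpleModule_range_mulLeftRight k (H := H)
  let f' : Module.End (Module.End (AlgHom.mulLeftRight k H).range H) H :=
    { toFun := f
      map_add' := f.map_add
      map_smul' := fun g x => by
        obtain ⟨c, hc⟩ := exists_smul_eq_of_endomorphism k g
        simp [hc] }
  let b := Module.finBasis k H
  obtain ⟨⟨_, r, rfl⟩, hr⟩ := jacobson_density (R := (AlgHom.mulLeftRight k H).range) f'
    (univ.image b)
  refine ⟨r, b.ext fun i => ?_⟩
  exact (hr (b i) (by simp)).symm

end Density

section PolynomialFunctions

variable {k H : Type*} [Field k] [DivisionRing H] [Algebra k H]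

theorem const_mem_polyFunRing (c : H) : Function.const H c ∈ polyFunRing H :=
  Subring.subset_closure (Or.inl ⟨c, rfl⟩)

theorem id_mem_polyFunRing : (id : H → H) ∈ polyFunRing H :=
  Subring.subset_closure (Or.inr rfl)

theorem linearMap_mem_polyFunRing [Algebra.IsCentral k H] [Module.Finite k H] (f : H →ₗ[k] H) :
    ⇑f ∈ polyFunRing H := by
  obtain ⟨r, rfl⟩ := mulLeftRight_surjective k f
  induction r with
  | zero => rw [map_zero]; exact zero_mem (polyFunRing H)
  | add r s hr hs => rw [map_add]; exact add_mem hr hs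
  | tmul a c =>
    have : ⇑(AlgHom.mulLeftRight k H (a ⊗ₜ c)) =
        Function.const H a * id * Function.const H c.unop := by
      ext x
      simp
    rw [this]
    exact mul_mem (mul_mem (const_mem_polyFunRing a) id_mem_polyFunRing) (const_mem_polyFunRing _)

/-- The polynomial function on `H` attached to a polynomial with coefficients in `H` in the
coordinates with respect to a basis. -/
noncomputable def coordPolyFun {n : ℕ} (b : Module.Basis (Fin n) k H) :
    MvPolynomial (Fin n) k ⊗[k] H →ₐ[k] (H → H) :=
  Algebra.TensorProduct.lift
    (AlgHom.pi fun x => (Algebra.ofId k H).comp (MvPolynomial.aeval (b.repr x)))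
    (Pi.constAlgHom k H H)
    fun p y => by
      ext x
      exact Algebra.commutes _ _

theorem coordPolyFun_tmul {n : ℕ} (b : Module.Basis (Fin n) k H) (p : MvPolynomial (Fin n) k)
    (y x : H) : coordPolyFun b (p ⊗ₜ y) x = MvPolynomial.eval (b.repr x) p • y := by
  refine (congrFun (Algebra.TensorProduct.lift_tmul _ _ _ p y) x).trans ?_
  simp [Algebra.smul_def, Algebra.ofId_apply, MvPolynomial.aeval_eq_eval]

theorem coordPolyFun_injective [Infinite k] {n : ℕ} (b : Module.Basis (Fin n) k H) :
    Function.Injective (coordPolyFun b) := by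
  have hrepr : ∀ w i x, b.repr (coordPolyFun b w x) i =
      MvPolynomial.eval (b.repr x)
        ((Algebra.TensorProduct.basis (MvPolynomial (Fin n) k) b).repr w i) := by
    intro w i x
    induction w with
    | zero => simp
    | add w w' h h' => simp [h, h']
    | tmul p y =>
      rw [coordPolyFun_tmul, Algebra.TensorProduct.basis_repr_tmul]
      simp [MvPolynomial.algebraMap_eq, mul_comm]
  rw [injective_iff_map_eq_zero]
  intro w hw
  refine (Algebra.TensorProduct.basis (MvPolynomial (Fin n) k) b).repr.injective ?_
  ext1 i
  refine MvPolynomial.funext fun x => ?_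
  have := hrepr w i (b.equivFun.symm x)
  rw [hw] at this
  simpa [Module.Basis.equivFun] using this.symm

theorem range_coordPolyFun [Algebra.IsCentral k H] {n : ℕ} (b : Module.Basis (Fin n) k H) :
    (coordPolyFun b).toRingHom.range = polyFunRing H := by
  have := Module.Finite.of_basis b
  refine le_antisymm ?_ (Subring.closure_le.2 ?_)
  · rintro _ ⟨w, rfl⟩
    induction w with
    | zero => rw [map_zero]; exact zero_mem _
    | add w w' h h' => rw [map_add]; exact add_mem h h'
    | tmul p y =>
      have hy : coordPolyFun b (1 ⊗ₜ y) ∈ polyFunRing H := by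
        convert const_mem_polyFunRing y
        ext x
        simp [coordPolyFun_tmul]
      have hp : coordPolyFun b (p ⊗ₜ 1) ∈ polyFunRing H := by
        induction p using MvPolynomial.induction_on with
        | C c =>
          convert const_mem_polyFunRing (algebraMap k H c)
          ext x
          simp [coordPolyFun_tmul, Algebra.algebraMap_eq_smul_one]
        | add p q h h' => rw [TensorProduct.add_tmul, map_add]; exact add_mem h h'
        | mul_X p i h =>
          rw [← mul_one (1 : H), ← Algebra.TensorProduct.tmul_mul_tmul, map_mul]
          refine mul_mem h ?_
          convert linearMap_mem_polyFunRing ((Algebra.linearMap k H).comp (b.coord i))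
          ext x
          simp [coordPolyFun_tmul, Algebra.algebraMap_eq_smul_one]
      have := mul_mem hp hy
      rwa [← map_mul, Algebra.TensorProduct.tmul_mul_tmul, one_mul, mul_one] at this
  · rintro _ (⟨c, rfl⟩ | rfl)
    · refine ⟨1 ⊗ₜ c, ?_⟩
      ext x
      simp [coordPolyFun_tmul]
    · refine ⟨∑ i, MvPolynomial.X i ⊗ₜ b i, ?_⟩
      ext x
      simp [coordPolyFun_tmul, Finset.sum_apply, b.sum_repr]

/-- The ring of polynomial functions on `H` is the polynomial ring over `H` in the coordinates. -/
noncomputable def coordPolyFunEquiv [Algebra.IsCentral k H] [Infinite k] {n : ℕ}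
    (b : Module.Basis (Fin n) k H) : MvPolynomial (Fin n) k ⊗[k] H ≃+* polyFunRing H :=
  (RingEquiv.ofBijective (coordPolyFun b).toRingHom.rangeRestrict
    ⟨fun _ _ h => coordPolyFun_injective b (congrArg Subtype.val h),
      (coordPolyFun b).toRingHom.rangeRestrict_surjective⟩).trans
    (RingEquiv.subringCongr (range_coordPolyFun b))

end PolynomialFunctions

section FractionTensor

variable {k A E H F : Type*} [Field k] [CommRing A] [Algebra k A] [Field E]
  [Ring H] [Algebra k H] [DivisionRing F]

theorem IsClassicalRightQuotient.comp_ringEquiv {R S F : Type*} [Ring R] [Ring S] [DivisionRing F]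
    {φ : R →+* F} (hφ : IsClassicalRightQuotient φ) (f : S ≃+* R) :
    IsClassicalRightQuotient (φ.comp (f : S →+* R)) := by
  refine ⟨hφ.1.comp f.injective, fun x => ?_⟩
  obtain ⟨a, b, hb, h⟩ := hφ.2 x
  exact ⟨f.symm a, f.symm b, by simpa using hb, by simpa using h⟩

theorem isUnit_of_ne_zero_tensorProduct [Algebra k E] [Module.Finite k H] [Nontrivial H]
    [NoZeroDivisors (E ⊗[k] H)] {w : E ⊗[k] H} (hw : w ≠ 0) : IsUnit w := by
  have : Nontrivial (E ⊗[k] H) := tmul_one_injective.nontrivial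
  have : IsDomain (E ⊗[k] H) := NoZeroDivisors.to_isDomain _
  let D : DivisionRing (E ⊗[k] H) := divisionRingOfFiniteDimensional E (E ⊗[k] H)
  exact isUnit_iff_ne_zero.2 hw

theorem IsClassicalRightQuotient.map_tmul_one_mem_center {φ : A ⊗[k] H →+* F}
    (hφ : IsClassicalRightQuotient φ) (a : A) : φ (a ⊗ₜ 1) ∈ Subring.center F := by
  have hcomm : ∀ w, Commute (φ (a ⊗ₜ 1)) (φ w) := fun w => by
    refine Commute.map ?_ φ
    induction w with
    | zero => exact Commute.zero_right _
    | add w w' h h' => exact h.add_right h'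
    | tmul x y => simp [Commute, SemiconjBy, mul_comm]
  rw [Subring.mem_center_iff]
  intro x
  obtain ⟨b, c, -, rfl⟩ := hφ.2 x
  exact ((hcomm b).mul_right (hcomm c).inv_right₀).symm.eq

/-- A field of fractions of `A` maps to the center of any division ring of fractions
of `A ⊗ H`. -/
theorem IsClassicalRightQuotient.exists_lift_center {φ : A ⊗[k] H →+* F}
    (hφ : IsClassicalRightQuotient φ) [Nontrivial H] [IsDomain A] {j : A →+* E}
    (hj : IsFieldOfFractions j) :
    ∃ g : E →+* Subring.center F, ∀ a, (g (j a) : F) = φ (a ⊗ₜ 1) := by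
  let _ : Algebra A E := j.toAlgebra
  have : FaithfulSMul A E := (faithfulSMul_iff_algebraMap_injective A E).2 hj.1
  have : IsFractionRing A E := IsFractionRing.of_field _ _ fun z => by
    obtain ⟨a, b, hb, h⟩ := hj.2 z
    exact ⟨a, b, (eq_div_iff ((map_ne_zero_iff j hj.1).2 hb)).2 h⟩
  let α : A →+* Subring.center F :=
    (φ.comp (Algebra.TensorProduct.includeLeft : A →ₐ[k] A ⊗[k] H).toRingHom).codRestrict _
      hφ.map_tmul_one_mem_center
  have hα : Function.Injective α := fun a b h =>
    Algebra.TensorProduct.includeLeft_injective (S := k) (algebraMap k H).injective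
      (hφ.1 (congrArg Subtype.val h))
  exact ⟨IsFractionRing.lift hα,
    fun a => congrArg Subtype.val (IsFractionRing.lift_algebraMap hα a)⟩

theorem IsClassicalRightQuotient.nonempty_ringEquiv_tensorProduct [Algebra k E] {φ : A ⊗[k] H →+* F}
    (hφ : IsClassicalRightQuotient φ) [IsDomain A] [Nontrivial H] [Module.Finite k H]
    [NoZeroDivisors (E ⊗[k] H)] {j : A →ₐ[k] E} (hj : IsFieldOfFractions (j : A →+* E)) :
    Nonempty (F ≃+* E ⊗[k] H) := by
  obtain ⟨g, hg⟩ : ∃ g : E →+* Subring.center F, ∀ a, (g (j a) : F) = φ (a ⊗ₜ 1) :=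
    hφ.exists_lift_center hj
  have hgk : ∀ c : k, (g (algebraMap k E c) : F) = φ (algebraMap k (A ⊗[k] H) c) := fun c => by
    rw [← j.commutes c]
    exact hg _
  let _ : Algebra k F := ((Subring.center F).subtype.comp (g.comp (algebraMap k E))).toAlgebra'
    fun c x => (Subring.mem_center_iff.1 (g (algebraMap k E c)).2 x).symm
  let α : E →ₐ[k] F := { (Subring.center F).subtype.comp g with commutes' := fun c => rfl }
  let β : H →ₐ[k] F :=
    { φ.comp (Algebra.TensorProduct.includeRight : H →ₐ[k] A ⊗[k] H).toRingHom with
      commutes' := fun c => by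
        refine Eq.trans ?_ (hgk c).symm
        exact congrArg φ ((Algebra.TensorProduct.includeRight : H →ₐ[k] A ⊗[k] H).commutes c) }
  let Ψ : E ⊗[k] H →ₐ[k] F := Algebra.TensorProduct.lift α β fun x y =>
    (Subring.mem_center_iff.1 (g x).2 (β y)).symm
  have hΨ : ∀ w : A ⊗[k] H, Ψ (Algebra.TensorProduct.map j (AlgHom.id k H) w) = φ w := by
    intro w
    induction w with
    | zero => simp
    | add w w' h h' => rw [map_add, map_add, map_add, h, h']
    | tmul x y =>
      have : Ψ (j x ⊗ₜ y) = (g (j x) : F) * φ (1 ⊗ₜ y) := Algebra.TensorProduct.lift_tmul ..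
      rw [Algebra.TensorProduct.map_tmul, AlgHom.id_apply, this, hg, ← map_mul]
      simp
  have hinj : Function.Injective Ψ := by
    rw [injective_iff_map_eq_zero]
    intro w hw
    by_contra hw0
    exact ((isUnit_of_ne_zero_tensorProduct hw0).map Ψ).ne_zero hw
  refine ⟨(RingEquiv.ofBijective Ψ ⟨hinj, fun x => ?_⟩).symm⟩
  obtain ⟨a, b, hb, rfl⟩ := hφ.2 x
  rw [← hΨ, ← hΨ]
  obtain ⟨v, hv⟩ : IsUnit (Algebra.TensorProduct.map j (AlgHom.id k H) b) := by
    refine isUnit_of_ne_zero_tensorProduct fun h => ?_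
    have := hΨ b
    rw [h, map_zero] at this
    exact hb (hφ.1 (by rw [← this, map_zero]))
  refine ⟨Algebra.TensorProduct.map j (AlgHom.id k H) a * ↑v⁻¹, ?_⟩
  rw [map_mul, ← hv]
  congr 1
  refine eq_inv_of_mul_eq_one_left ?_
  rw [← map_mul, Units.inv_mul, map_one]

end FractionTensor

theorem Subring.center_isCentral (H : Type*) [DivisionRing H] :
    Algebra.IsCentral (Subring.center H) H :=
  ⟨fun x hx => Algebra.mem_bot.2
    ⟨⟨x, Subring.mem_center_iff.2 fun y => Subalgebra.mem_center_iff.1 hx y⟩, rfl⟩⟩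

theorem alternating_groups_are_galois_groups_over_polyFun_fractions
    {H : Type v} [DivisionRing H] [FiniteDimensional (Subring.center H) H]
    (hchar : CharZero (Subring.center H))
    {F : Type u} [DivisionRing F]
    (φ : polyFunRing H →+* F) (hφ : IsClassicalRightQuotient φ)
    (m : ℕ) (hm : 4 ≤ m) :
    ∃ (M : Type u) (instM : DivisionRing M),
      letI := instM
      ∃ ι : F →+* M, Function.Injective ι ∧ IsGaloisExt ι ∧
        Nonempty (fixingAut ι ≃* alternatingGroup (Fin m)) := by
  have := Subring.center_isCentral H
  obtain ⟨n, hn⟩ := Nat.exists_eq_add_of_lt (Module.finrank_pos (R := Subring.center H) (M := H))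
  let b : Module.Basis (Fin (n + 1)) (Subring.center H) H :=
    (Module.finBasis (Subring.center H) H).reindex (finCongr (by omega))
  have hφ' := hφ.comp_ringEquiv (coordPolyFunEquiv b)
  obtain ⟨E, L, _, _, _, _, _, _, j, hj, _, _, _, ⟨eA⟩⟩ :=
    exists_isGalois_alternatingGroup_over_mvPolynomial (Subring.center H) H n hm
  have : NoZeroDivisors (E ⊗[Subring.center H] H) :=
    noZeroDivisors_tensorProduct_of_injective (IsScalarTower.toAlgHom (Subring.center H) E L)
  obtain ⟨ψ⟩ := hφ'.nonempty_ringEquiv_tensorProduct hj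
  have : Small.{u} (E ⊗[Subring.center H] H) := ⟨F, ⟨ψ.symm.toEquiv⟩⟩
  have : Small.{u} (L ⊗[Subring.center H] H) :=
    small_tensorProduct_of_finiteDimensional (E := E)
  obtain ⟨M, instM, ⟨θ⟩⟩ :=
    exists_divisionRing_ringEquiv_tensorProduct.{u} (k := Subring.center H) (L := L) (H := H)
  obtain ⟨e⟩ := nonempty_fixingAut_mulEquiv_gal ψ θ
  exact ⟨M, instM, tensorInclusionTransport ψ θ, RingHom.injective _,
    isGaloisExt_tensorInclusionTransport ψ θ, ⟨e.trans eA⟩⟩
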